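/- Let t ↦ μ_t be a weakly continuous curve of probability measures on a bounded domain M ⊆ ℝⁿ, and suppose for some K < ∞ the set A_K = {t : μ_t = g_t dx with ‖g_t‖_{L^∞} ≤ K} has Lebesgue measure m_K > 0. Then the barycenter μ^∞ (the minimizer of ∫₀¹ W₂²(μ, μ_t) dt) is absolutely continuous with respect to Lebesgue measure with density g^∞ satisfying ‖g^∞‖_{L^∞} ≤ K / m_K^n. -/

import Mathlib

open MeasureTheory Set

noncomputable section

/-- `ℝⁿ` with the Euclidean norm. -/
abbrev En (n : ℕ) := EuclideanSpace ℝ (Fin n)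

/-- `γ` is a coupling of `μ` and `ν`. -/
def IsCoupling {n : ℕ} (γ : Measure (En n × En n)) (μ ν : Measure (En n)) : Prop :=
  γ.map Prod.fst = μ ∧ γ.map Prod.snd = ν

/-- The squared quadratic Wasserstein distance `W₂²(μ,ν)`. -/
def W2sq {n : ℕ} (μ ν : Measure (En n)) : ℝ :=
  sInf { c | ∃ γ : Measure (En n × En n), IsCoupling γ μ ν ∧ c = ∫ p, ‖p.1 - p.2‖ ^ 2 ∂γ }

/-- `μ` has finite second moment. -/
def FinSecMom {n : ℕ} (μ : Measure (En n)) : Prop := Integrable (fun x => ‖x‖ ^ 2) μ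

/-- The curve `t ↦ μ t` is weakly continuous on `s`. -/
def WeakContOn {n : ℕ} (μ : ℝ → Measure (En n)) (s : Set ℝ) : Prop :=
  ∀ f : BoundedContinuousFunction (En n) ℝ, ContinuousOn (fun t => ∫ x, f x ∂(μ t)) s

/-- `μb` is a barycenter of the curve `t ↦ μ t`, `t ∈ [0,1]`: it minimizes
`ν ↦ ∫₀¹ W₂²(μ_t, ν) dt` over probability measures with finite second moment. -/
def IsBarycenter {n : ℕ} (μ : ℝ → Measure (En n)) (μb : Measure (En n)) : Prop :=
  IsProbabilityMeasure μb ∧ FinSecMom μb ∧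
    ∀ ν : Measure (En n), IsProbabilityMeasure ν → FinSecMom ν →
      ∫ t in Icc (0:ℝ) 1, W2sq (μ t) μb ≤ ∫ t in Icc (0:ℝ) 1, W2sq (μ t) ν

/-- Existence of an optimal plan for the multi-marginal transport problem on a compact space. -/
theorem exists_optimal_multimarginal_plan {ι X : Type*} [Fintype ι] [MetricSpace X] [CompactSpace X]
    [MeasurableSpace X] [BorelSpace X] (μ : ι → Measure X) [∀ i, IsProbabilityMeasure (μ i)]
    (c : (ι → X) → ℝ) (hc : Continuous c) :
    ∃ γ : Measure (ι → X), IsProbabilityMeasure γ ∧ (∀ i, γ.map (Function.eval i) = μ i) ∧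
      ∀ γ' : Measure (ι → X), IsProbabilityMeasure γ' → (∀ i, γ'.map (Function.eval i) = μ i) →
        ∫ x, c x ∂γ ≤ ∫ x, c x ∂γ' := by
  let μ' : ι → ProbabilityMeasure X := fun i => ⟨μ i, inferInstance⟩
  let S : Set (ProbabilityMeasure (ι → X)) :=
    ⋂ i, {γ | γ.map (continuous_apply i).measurable.aemeasurable = μ' i}
  have hmem : ∀ γ : ProbabilityMeasure (ι → X), γ ∈ S ↔
      ∀ i, (γ : Measure (ι → X)).map (Function.eval i) = μ i := by
    intro γ
    simp only [S, mem_iInter, mem_ofPred_eq]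
    refine forall_congr' fun i => ?_
    rw [← ProbabilityMeasure.toMeasure_injective.eq_iff]
    rfl
  have hS : IsCompact S :=
    (isClosed_iInter fun i => isClosed_eq
      (ProbabilityMeasure.continuous_map (continuous_apply i)) continuous_const).isCompact
  have hne : S.Nonempty := by
    refine ⟨⟨Measure.pi μ, inferInstance⟩, (hmem _).2 fun i => ?_⟩
    exact (measurePreserving_eval μ i).map_eq
  obtain ⟨γ, hγ, hmin⟩ := hS.exists_isMinOn hne
    (ProbabilityMeasure.continuous_integral_continuousMap (⟨c, hc⟩ : C((ι → X), ℝ))).continuousOn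
  refine ⟨γ, inferInstance, (hmem γ).1 hγ, fun γ' h1 h2 => ?_⟩
  exact hmin (a := (⟨γ', h1⟩ : ProbabilityMeasure (ι → X))) ((hmem ⟨γ', h1⟩).2 h2)

/-- The support of an optimal plan is cyclically monotone for the cost: permuting one coordinate
among finitely many points of the support does not decrease the total cost. -/
theorem sum_cost_le_sum_cost_update {ι X : Type*} [Fintype ι] [DecidableEq ι] [MetricSpace X]
    [CompactSpace X] [MeasurableSpace X] [BorelSpace X]
    {c : (ι → X) → ℝ} (hc : Continuous c) (γ : Measure (ι → X)) [IsProbabilityMeasure γ]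
    (hopt : ∀ γ' : Measure (ι → X), IsProbabilityMeasure γ' →
      (∀ i, γ'.map (Function.eval i) = γ.map (Function.eval i)) → ∫ x, c x ∂γ ≤ ∫ x, c x ∂γ')
    {k : ℕ} (ω : Fin k → ι → X) (hω : ∀ j, ω j ∈ γ.support) (σ : Equiv.Perm (Fin k)) (i : ι) :
    ∑ j, c (ω j) ≤ ∑ j, c (Function.update (ω j) i (ω (σ j) i)) := by
  by_contra! hlt
  let q : (Fin k → ι → X) → Fin k → ι → X := fun η j => Function.update (η j) i (η (σ j) i)
  have hqc : ∀ j, Continuous fun η => q η j := fun j =>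
    (continuous_apply j).update i ((continuous_apply i).comp (continuous_apply (σ j)))
  let G : (Fin k → ι → X) → ℝ := fun η => ∑ j, c (η j) - ∑ j, c (q η j)
  have hGc : Continuous G :=
    (continuous_finsetSum _ fun j _ => hc.comp (continuous_apply j)).sub
      (continuous_finsetSum _ fun j _ => hc.comp (hqc j))
  have hG0 : 0 < G ω := sub_pos.2 hlt
  have hk : 0 < k := by
    rcases Nat.eq_zero_or_pos k with rfl | h
    · simp at hlt
    · exact h
  obtain ⟨U, hU, hUG⟩ : ∃ U : Fin k → Set (ι → X), (∀ j, IsOpen (U j) ∧ ω j ∈ U j) ∧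
      ∀ η, (∀ j, η j ∈ U j) → G ω / 2 < G η := by
    have h1 : {η | G ω / 2 < G η} ∈ nhds ω :=
      (isOpen_lt continuous_const hGc).mem_nhds (by simpa using half_lt_self hG0)
    obtain ⟨V, hVs, hVo, hV⟩ := mem_nhds_iff.1 h1
    obtain ⟨u, hu, hu'⟩ := isOpen_pi_iff'.1 hVo ω hV
    exact ⟨u, hu, fun η hη => hVs (hu' fun j _ => hη j)⟩
  have hUpos : ∀ j, γ (U j) ≠ 0 := fun j =>
    ((Measure.mem_support_iff_forall _).1 (hω j) _ ((hU j).1.mem_nhds (hU j).2)).ne'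
  let β : Fin k → Measure (ι → X) := fun j => ProbabilityTheory.cond γ (U j)
  have hβ : ∀ j, IsProbabilityMeasure (β j) := fun j =>
    ProbabilityTheory.cond_isProbabilityMeasure (hUpos j)
  let P : Measure (Fin k → ι → X) := Measure.pi β
  have hPev : ∀ j, P.map (fun η => η j) = β j := fun j => (measurePreserving_eval β j).map_eq
  have hPU : ∀ᵐ η ∂P, ∀ j, η j ∈ U j := by
    refine ae_all_iff.2 fun j => ?_
    have : ∀ᵐ x ∂(P.map fun η => η j), x ∈ U j := by
      rw [hPev]
      exact ProbabilityTheory.ae_cond_mem (hU j).1.measurableSet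
    exact ae_of_ae_map (measurable_pi_apply j).aemeasurable this
  obtain ⟨e, he0, he⟩ : ∃ e : NNReal, 0 < e ∧ ∀ j, (e : ENNReal) * (k : ENNReal) ≤ γ (U j) := by
    have : Nonempty (Fin k) := ⟨⟨0, hk⟩⟩
    obtain ⟨j0, hj0⟩ := Finite.exists_min fun j => (γ (U j)).toNNReal
    refine ⟨(γ (U j0)).toNNReal / k, ?_, fun j => ?_⟩
    · exact div_pos (ENNReal.toNNReal_pos (hUpos j0) (measure_ne_top _ _)) (by exact_mod_cast hk)
    · have h2 : ((γ (U j0)).toNNReal / k) * (k : NNReal) ≤ (γ (U j)).toNNReal := by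
        rw [div_mul_cancel₀ _ (by exact_mod_cast hk.ne')]
        exact hj0 j
      have h3 := ENNReal.coe_le_coe.2 h2
      rw [ENNReal.coe_toNNReal (measure_ne_top _ _)] at h3
      simpa using h3
  let ρ : Measure (ι → X) := e • ∑ j, β j
  let ρ' : Measure (ι → X) := e • ∑ j, P.map fun η => q η j
  have hqm : ∀ j, Measurable fun η => q η j := fun j => (hqc j).measurable
  have hβle : ∀ j, (e * k : ENNReal) • β j ≤ γ := by
    intro j
    refine Measure.le_iff.2 fun s hs => ?_
    rw [Measure.smul_apply, smul_eq_mul, ProbabilityTheory.cond_apply (hU j).1.measurableSet]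
    calc (e * k : ENNReal) * ((γ (U j))⁻¹ * γ (U j ∩ s))
        ≤ γ (U j) * ((γ (U j))⁻¹ * γ (U j ∩ s)) := by gcongr; exact he j
      _ = γ (U j ∩ s) := by
        rw [← mul_assoc, ENNReal.mul_inv_cancel (hUpos j) (measure_ne_top _ _), one_mul]
      _ ≤ γ s := measure_mono inter_subset_right
  have hρle : ρ ≤ γ := by
    refine Measure.le_iff.2 fun s hs => ?_
    have hk' : (k : ENNReal) ≠ 0 := by exact_mod_cast hk.ne'
    have h4 : ∀ j, (e : ENNReal) * β j s ≤ γ s / k := by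
      intro j
      rw [ENNReal.le_div_iff_mul_le (Or.inl hk') (Or.inl (by simp))]
      have := Measure.le_iff.1 (hβle j) s hs
      rw [Measure.smul_apply, smul_eq_mul] at this
      calc (e : ENNReal) * β j s * k = e * k * β j s := by ring
        _ ≤ γ s := this
    calc ρ s = ∑ j, (e : ENNReal) * β j s := by
          simp only [ρ, Measure.smul_apply, Measure.coe_finsetSum, Finset.sum_apply]
          rw [ENNReal.smul_def, smul_eq_mul, Finset.mul_sum]
      _ ≤ ∑ _j : Fin k, γ s / k := Finset.sum_le_sum fun j _ => h4 j
      _ = γ s := by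
        rw [Finset.sum_const, Finset.card_univ, Fintype.card_fin, nsmul_eq_mul]
        exact ENNReal.mul_div_cancel hk' (by simp)
  have : IsFiniteMeasure ρ := ⟨(hρle univ).trans_lt (measure_lt_top _ _)⟩
  have : ∀ j, IsProbabilityMeasure (P.map fun η => q η j) := fun j =>
    Measure.isProbabilityMeasure_map (hqm j).aemeasurable
  let γ₀ := γ - ρ
  have hγ : γ₀ + ρ = γ := Measure.sub_add_cancel_of_le hρle
  have : IsFiniteMeasure γ₀ := ⟨(Measure.sub_le univ).trans_lt (measure_lt_top γ _)⟩
  have hmapsum : ∀ (l : ι) (m : Fin k → Measure (ι → X)),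
      (e • ∑ j, m j).map (Function.eval l) = e • ∑ j, (m j).map (Function.eval l) := by
    intro l m
    rw [Measure.map_smul, Measure.map_finset_sum (measurable_pi_apply l).aemeasurable]
  have hmarg : ∀ l, ρ'.map (Function.eval l) = ρ.map (Function.eval l) := by
    intro l
    simp only [ρ, ρ', hmapsum]
    congr 1
    have h5 : ∀ j, (P.map fun η => q η j).map (Function.eval l) =
        P.map fun η => q η j l := fun j => Measure.map_map (measurable_pi_apply l) (hqm j)
    have h6 : ∀ j, (β j).map (Function.eval l) = P.map fun η => η j l := fun j => by
      rw [← hPev j]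
      exact Measure.map_map (measurable_pi_apply l) (measurable_pi_apply j)
    simp only [h5, h6]
    by_cases hl : l = i
    · subst hl
      simp only [q, Function.update_self]
      exact Equiv.sum_comp σ fun j => P.map fun η => η j l
    · simp only [q, Function.update_of_ne hl]
  let γ' := γ₀ + ρ'
  have hev : ∀ l, γ'.map (Function.eval l) = γ.map (Function.eval l) := by
    intro l
    rw [← hγ, Measure.map_add _ _ (measurable_pi_apply l),
      Measure.map_add _ _ (measurable_pi_apply l), hmarg]
  have hγ'p : IsProbabilityMeasure γ' := by
    constructor
    have h7 := congrArg (fun m => m univ) (hev i)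
    simp only [Measure.map_apply (measurable_pi_apply i) MeasurableSet.univ, preimage_univ] at h7
    rw [h7]
    exact measure_univ
  have hint : ∀ m : Measure (ι → X), IsFiniteMeasure m → Integrable c m := fun m _ =>
    hc.integrable_of_hasCompactSupport (HasCompactSupport.of_compactSpace c)
  have : IsFiniteMeasure ρ' := by
    exact ⟨lt_of_le_of_lt (Measure.le_add_left le_rfl univ) (measure_lt_top γ' univ)⟩
  have hcmp := hopt γ' hγ'p hev
  rw [← hγ, integral_add_measure (hint _ inferInstance) (hint _ inferInstance),
    integral_add_measure (hint _ inferInstance) (hint _ inferInstance)] at hcmp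
  have hGint : Integrable G P :=
    hGc.integrable_of_hasCompactSupport (HasCompactSupport.of_compactSpace G)
  have hcm : ∀ m : Measure (ι → X), AEStronglyMeasurable c m := fun m =>
    hc.measurable.aestronglyMeasurable
  have hcint : ∀ f : (Fin k → ι → X) → ι → X, Continuous f → Integrable (fun η => c (f η)) P :=
    fun f hf => (hc.comp hf).integrable_of_hasCompactSupport (HasCompactSupport.of_compactSpace _)
  have h8 : ∫ x, c x ∂ρ = e * ∫ η, ∑ j, c (η j) ∂P := by
    have : ∀ j, ∫ x, c x ∂β j = ∫ η, c (η j) ∂P := fun j => by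
      rw [← hPev j, integral_map (measurable_pi_apply j).aemeasurable (hcm _)]
    simp only [ρ]
    rw [integral_smul_nnreal_measure, integral_finsetSum_measure fun j _ => hint _ inferInstance,
      integral_finsetSum _ fun j _ => hcint _ (continuous_apply j)]
    simp only [this]
    rfl
  have h9 : ∫ x, c x ∂ρ' = e * ∫ η, ∑ j, c (q η j) ∂P := by
    simp only [ρ']
    rw [integral_smul_nnreal_measure, integral_finsetSum_measure fun j _ => hint _ inferInstance,
      integral_finsetSum _ fun j _ => hcint _ (hqc j)]
    simp only [integral_map (hqm _).aemeasurable (hcm _)]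
    rfl
  have h10 : G ω / 2 ≤ ∫ η, G η ∂P := by
    have : ∫ _η, G ω / 2 ∂P ≤ ∫ η, G η ∂P := by
      refine integral_mono_ae (integrable_const _) hGint ?_
      filter_upwards [hPU] with η hη using (hUG η hη).le
    simpa using this
  have h11 : ∫ η, G η ∂P = ∫ η, ∑ j, c (η j) ∂P - ∫ η, ∑ j, c (q η j) ∂P :=
    integral_sub (integrable_finsetSum _ fun j _ => hcint _ (continuous_apply j))
      (integrable_finsetSum _ fun j _ => hcint _ (hqc j))
  have he' : (0 : ℝ) < e := he0
  rw [h8, h9] at hcmp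
  have : (e : ℝ) * ∫ η, G η ∂P ≤ 0 := by rw [h11]; linarith
  nlinarith [mul_pos he' hG0]

/-- A linear map whose graph is cyclically monotone is symmetric. -/
theorem inner_map_comm_of_cyclicallyMonotone {E : Type*} [NormedAddCommGroup E]
    [InnerProductSpace ℝ E] (D : E →ₗ[ℝ] E)
    (hD : ∀ (k : ℕ) (v : Fin k → E) (σ : Equiv.Perm (Fin k)),
      ∑ j, inner ℝ (v j) (D (v (σ j))) ≤ ∑ j, inner ℝ (v j) (D (v j))) (u v : E) :
    inner ℝ u (D v) = inner ℝ v (D u) := by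
  have key : ∀ u v : E, inner ℝ u (D v) - inner ℝ v (D u) ≤ 0 := by
    intro u v
    set a := inner ℝ u (D v) - inner ℝ v (D u) with ha
    set b := inner ℝ u (D u) + inner ℝ v (D v) with hb
    have hM : ∀ m : ℕ, 3 ≤ m → Real.sin (2 * Real.pi / (m + 1)) * a ≤
        (1 - Real.cos (2 * Real.pi / (m + 1))) * b := by
      intro m hm3
      set θ := 2 * Real.pi / ((m : ℝ) + 1) with hθ
      have hθm : ((m : ℝ) + 1) * θ = 2 * Real.pi := by rw [hθ]; field_simp
      have hθ0 : 0 < θ := by positivity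
      have hsin : 0 < Real.sin θ := by
        refine Real.sin_pos_of_pos_of_lt_pi hθ0 ?_
        have : (3 : ℝ) ≤ m := by exact_mod_cast hm3
        nlinarith [Real.pi_pos]
      let F : ℕ → ℝ := fun j => (Real.sin ((2 * (j : ℝ) - 1) * θ) - Real.sin ((2 * (j : ℝ)) * θ)) *
          (inner ℝ u (D u) - inner ℝ v (D v)) +
        (Real.cos ((2 * (j : ℝ)) * θ) - Real.cos ((2 * (j : ℝ) - 1) * θ)) *
          (inner ℝ u (D v) + inner ℝ v (D u))
      let p : ℝ → E := fun s => Real.cos (s * θ) • u + Real.sin (s * θ) • v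
      have hper : ∀ s, p (s + (m + 1)) = p s := by
        intro s
        simp only [p]
        rw [add_mul, hθm, Real.cos_add_two_pi, Real.sin_add_two_pi]
      have hrot : ∀ j : Fin (m + 1), p ((finRotate (m + 1) j : Fin (m + 1)) : ℕ) =
          p ((j : ℕ) + 1) := by
        intro j
        rw [finRotate_apply]
        rcases eq_or_ne j (Fin.last m) with rfl | hj
        · have := hper 0
          simp only [zero_add] at this
          simp [this]
        · rw [Fin.val_add_one_of_lt (Fin.lt_last_iff_ne_last.2 hj)]
          push_cast
          rfl
      have hmain := hD (m + 1) (fun j => p (j : ℕ)) (finRotate (m + 1))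
      simp only [hrot] at hmain
      rw [Fin.sum_univ_eq_sum_range (fun j : ℕ => inner ℝ (p j) (D (p (j + 1)))),
        Fin.sum_univ_eq_sum_range (fun j : ℕ => inner ℝ (p j) (D (p j)))] at hmain
      have hB : ∀ s t : ℝ, inner ℝ (p s) (D (p t)) =
          Real.cos (s * θ) * Real.cos (t * θ) * inner ℝ u (D u) +
          Real.cos (s * θ) * Real.sin (t * θ) * inner ℝ u (D v) +
          Real.sin (s * θ) * Real.cos (t * θ) * inner ℝ v (D u) +
          Real.sin (s * θ) * Real.sin (t * θ) * inner ℝ v (D v) := by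
        intro s t
        simp only [p, map_add, map_smul, inner_add_left, inner_add_right, real_inner_smul_left,
          real_inner_smul_right]
        ring
      have hdiff : ∀ j : ℕ, 4 * Real.sin θ *
          (inner ℝ (p j) (D (p j)) - inner ℝ (p j) (D (p (j + 1)))) =
          2 * Real.sin θ * ((1 - Real.cos θ) * b - Real.sin θ * a) + (F (j + 1 : ℕ) - F j) := by
        intro j
        have e1 : ((j : ℝ) + 1) * θ = j * θ + θ := by ring
        have e2 : ((2 * ((j : ℝ) + 1) - 1) * θ) = (j * θ + j * θ) + θ := by ring
        have e3 : ((2 * ((j : ℝ) + 1)) * θ) = (j * θ + j * θ) + (θ + θ) := by ring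
        have e4 : ((2 * (j : ℝ) - 1) * θ) = (j * θ + j * θ) - θ := by ring
        have e5 : ((2 * (j : ℝ)) * θ) = (j * θ + j * θ) := by ring
        simp only [F, hB, ha, hb, Nat.cast_add, Nat.cast_one, e1, e2, e3, e4, e5, Real.cos_add,
          Real.sin_add, Real.cos_sub, Real.sin_sub]
        have r1 := Real.sin_sq_add_cos_sq ((j : ℝ) * θ)
        have r2 := Real.sin_sq_add_cos_sq θ
        generalize Real.cos ((j : ℝ) * θ) = c at *
        generalize Real.sin ((j : ℝ) * θ) = s at *
        generalize Real.cos θ = C at *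
        generalize Real.sin θ = S at *
        grind
      have hsum := Finset.sum_congr (rfl : Finset.range (m + 1) = Finset.range (m + 1))
        fun j _ => hdiff j
      rw [← Finset.mul_sum, Finset.sum_sub_distrib, Finset.sum_add_distrib,
        Finset.sum_range_sub (fun j : ℕ => F j), Finset.sum_const, Finset.card_range,
        nsmul_eq_mul] at hsum
      have hFper : F (m + 1 : ℕ) - F (0 : ℕ) = 0 := by
        have e1 : (2 * ((m : ℝ) + 1) - 1) * θ = -θ + ((2 : ℕ) : ℝ) * (2 * Real.pi) := by
          push_cast
          linarith
        have e2 : (2 * ((m : ℝ) + 1)) * θ = 0 + ((2 : ℕ) : ℝ) * (2 * Real.pi) := by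
          push_cast
          linarith
        simp only [F, Nat.cast_add, Nat.cast_one, e1, e2, Real.sin_add_nat_mul_two_pi,
          Real.cos_add_nat_mul_two_pi]
        simp
      rw [hFper] at hsum
      have hm : (0 : ℝ) < ((m + 1 : ℕ) : ℝ) := by positivity
      have h0 : 0 ≤ 4 * Real.sin θ * (∑ i ∈ Finset.range (m + 1), inner ℝ (p i) (D (p i)) -
          ∑ i ∈ Finset.range (m + 1), inner ℝ (p i) (D (p (i + 1)))) :=
        mul_nonneg (by positivity) (sub_nonneg.2 hmain)
      rw [hsum, add_zero] at h0
      have h1 := nonneg_of_mul_nonneg_right h0 hm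
      have h2 := nonneg_of_mul_nonneg_right h1 (by positivity)
      linarith
    by_contra! hpos
    obtain ⟨m, hm⟩ := exists_nat_gt (3 + Real.pi ^ 2 * |b| / a)
    have hb0 : 0 ≤ Real.pi ^ 2 * |b| / a := by positivity
    have hm3 : (3 : ℝ) < m := by linarith
    have h1 := hM m (by exact_mod_cast hm3.le)
    set θ := 2 * Real.pi / ((m : ℝ) + 1) with hθ
    have hθ0 : 0 < θ := by positivity
    have hθ2 : θ ≤ Real.pi / 2 := by
      rw [hθ, div_le_div_iff₀ (by positivity) two_pos]
      nlinarith [Real.pi_pos]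
    have h2 := Real.mul_le_sin hθ0.le hθ2
    have h3 := Real.one_sub_sq_div_two_le_cos (x := θ)
    have h4 : (2 / Real.pi * θ) * a ≤ (θ ^ 2 / 2) * |b| := by
      calc (2 / Real.pi * θ) * a ≤ Real.sin θ * a := by gcongr
        _ ≤ (1 - Real.cos θ) * b := h1
        _ ≤ (1 - Real.cos θ) * |b| :=
          mul_le_mul_of_nonneg_left (le_abs_self b) (sub_nonneg.2 (Real.cos_le_one θ))
        _ ≤ (θ ^ 2 / 2) * |b| := mul_le_mul_of_nonneg_right (by linarith) (abs_nonneg b)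
    have h5 : 4 * a ≤ Real.pi * θ * |b| := by
      have h6 : (2 / Real.pi * θ) * a * (2 * Real.pi) ≤ (θ ^ 2 / 2) * |b| * (2 * Real.pi) := by
        gcongr
      have h7 : (2 / Real.pi * θ) * a * (2 * Real.pi) = θ * (4 * a) := by field_simp; ring
      have h8 : (θ ^ 2 / 2) * |b| * (2 * Real.pi) = θ * (Real.pi * θ * |b|) := by ring
      rw [h7, h8] at h6
      exact le_of_mul_le_mul_left h6 hθ0
    have h9 : θ * ((m : ℝ) + 1) = 2 * Real.pi := by rw [hθ]; field_simp
    have h10 : Real.pi ^ 2 * |b| < a * (m + 1) := by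
      have : Real.pi ^ 2 * |b| / a < m + 1 := by linarith
      rw [div_lt_iff₀ hpos] at this
      linarith
    have h11 : 4 * a * (m + 1) ≤ Real.pi * θ * |b| * (m + 1) := by gcongr
    have h12 : Real.pi * θ * |b| * (m + 1) = 2 * (Real.pi ^ 2 * |b|) := by
      linear_combination (Real.pi * |b|) * h9
    nlinarith [mul_pos hpos (show (0 : ℝ) < (m : ℝ) + 1 by positivity)]
  have h1 := key u v
  have h2 := key v u
  linarith
open scoped Pointwise in
/-- At a Lebesgue density point of `s`, finitely many directions can be approximated simultaneously
by rescaled points of `s`. -/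
theorem exists_seq_of_density_one {n k : ℕ} (s : Set (En n)) (x : En n)
    (hx : Filter.Tendsto (fun r => volume (s ∩ Metric.closedBall x r) /
      volume (Metric.closedBall x r)) (nhdsWithin 0 (Ioi 0)) (nhds 1)) (v : Fin k → En n) :
    ∃ (r : ℕ → ℝ) (u : ℕ → Fin k → En n), (∀ m, 0 < r m) ∧ Filter.Tendsto r Filter.atTop (nhds 0) ∧
      (∀ m j, x + r m • u m j ∈ s) ∧
      ∀ j, Filter.Tendsto (fun m => u m j) Filter.atTop (nhds (v j)) := by
  have hstep : ∀ m : ℕ, ∃ (r : ℝ) (u : Fin k → En n), 0 < r ∧ r < 1 / ((m : ℝ) + 1) ∧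
      ∀ j, x + r • u j ∈ s ∧ dist (u j) (v j) < 1 / ((m : ℝ) + 1) := by
    intro m
    have hm : (0 : ℝ) < 1 / ((m : ℝ) + 1) := by positivity
    have h1 : ∀ j, ∀ᶠ r : ℝ in nhdsWithin 0 (Ioi 0),
        (s ∩ ({x} + r • Metric.ball (v j) (1 / ((m : ℝ) + 1)))).Nonempty := fun j =>
      Measure.eventually_nonempty_inter_smul_of_density_one volume s x hx _
        Metric.isOpen_ball.measurableSet (Metric.measure_ball_pos volume _ hm).ne'
    have h2 : ∀ᶠ r : ℝ in nhdsWithin 0 (Ioi 0), r < 1 / ((m : ℝ) + 1) :=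
      nhdsWithin_le_nhds (Iio_mem_nhds hm)
    have h3 : ∀ᶠ r : ℝ in nhdsWithin 0 (Ioi 0), 0 < r := self_mem_nhdsWithin
    obtain ⟨r, hr1, hr2, hr3⟩ := ((Filter.eventually_all.2 h1).and (h2.and h3)).exists
    have h4 : ∀ j, ∃ u, x + r • u ∈ s ∧ dist u (v j) < 1 / ((m : ℝ) + 1) := by
      intro j
      obtain ⟨y, hys, hy⟩ := hr1 j
      obtain ⟨a, ha, b, hb, rfl⟩ := Set.mem_add.1 hy
      obtain ⟨u, hu, rfl⟩ := Set.mem_smul_set.1 hb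
      rw [mem_singleton_iff] at ha
      subst ha
      exact ⟨u, hys, hu⟩
    choose u hu using h4
    exact ⟨r, u, hr3, hr2, hu⟩
  choose r u hr0 hr hu using hstep
  refine ⟨r, u, hr0, ?_, fun m j => (hu m j).1, fun j => ?_⟩
  · exact squeeze_zero (fun m => (hr0 m).le) (fun m => (hr m).le) tendsto_one_div_add_atTop_nhds_zero_nat
  · rw [tendsto_iff_dist_tendsto_zero]
    exact squeeze_zero (fun m => dist_nonneg) (fun m => ((hu m j).2).le)
      tendsto_one_div_add_atTop_nhds_zero_nat

/-- Difference quotients along the sequences of `exists_seq_of_density_one` converge to the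
derivative. -/
theorem tendsto_quotient_of_hasFDerivWithinAt {n k : ℕ} {s : Set (En n)} {x : En n}
    {T : En n → En n} {D : En n →L[ℝ] En n} (hT : HasFDerivWithinAt T D s x)
    {r : ℕ → ℝ} {u : ℕ → Fin k → En n} {v : Fin k → En n} (hr0 : ∀ m, 0 < r m)
    (hr : Filter.Tendsto r Filter.atTop (nhds 0)) (hs : ∀ m j, x + r m • u m j ∈ s)
    (hu : ∀ j, Filter.Tendsto (fun m => u m j) Filter.atTop (nhds (v j))) (j : Fin k) :
    Filter.Tendsto (fun m => (r m)⁻¹ • (T (x + r m • u m j) - T x)) Filter.atTop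
      (nhds (D (v j))) := by
  refine hT.lim (c := fun m => (r m)⁻¹) (d := fun m => r m • u m j) ?_
    (Filter.Eventually.of_forall fun m => hs m j) ?_
  · simpa using hr.smul (hu j)
  · refine (hu j).congr fun m => ?_
    rw [smul_smul, inv_mul_cancel₀ (hr0 m).ne', one_smul]

/-- The derivative of a cyclically monotone map at a density point is cyclically monotone. -/
theorem cyclicallyMonotone_fderivWithin {n : ℕ} {s : Set (En n)} {x : En n}
    (hx : Filter.Tendsto (fun r => volume (s ∩ Metric.closedBall x r) /
      volume (Metric.closedBall x r)) (nhdsWithin 0 (Ioi 0)) (nhds 1))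
    {T : En n → En n} {D : En n →L[ℝ] En n} (hT : HasFDerivWithinAt T D s x)
    (hcyc : ∀ (k : ℕ) (p : Fin k → En n) (σ : Equiv.Perm (Fin k)), (∀ j, p j ∈ s) →
      ∑ j, inner ℝ (p j) (T (p (σ j))) ≤ ∑ j, inner ℝ (p j) (T (p j)))
    (k : ℕ) (v : Fin k → En n) (σ : Equiv.Perm (Fin k)) :
    ∑ j, inner ℝ (v j) (D (v (σ j))) ≤ ∑ j, inner ℝ (v j) (D (v j)) := by
  obtain ⟨r, u, hr0, hr, hs, hu⟩ := exists_seq_of_density_one s x hx v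
  have hw := tendsto_quotient_of_hasFDerivWithinAt hT hr0 hr hs hu
  refine le_of_tendsto_of_tendsto'
    (tendsto_finsetSum _ fun j _ => (hu j).inner (hw (σ j)))
    (tendsto_finsetSum _ fun j _ => (hu j).inner (hw j)) fun m => ?_
  set w : Fin k → En n := fun j => (r m)⁻¹ • (T (x + r m • u m j) - T x) with hwdef
  have hTw : ∀ j, T (x + r m • u m j) = T x + r m • w j := fun j => by
    rw [hwdef, smul_smul, mul_inv_cancel₀ (hr0 m).ne', one_smul, add_sub_cancel]
  have h := hcyc k (fun j => x + r m • u m j) σ (hs m)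
  simp only [hTw, inner_add_left, inner_add_right, real_inner_smul_left, real_inner_smul_right,
    Finset.sum_add_distrib, ← Finset.mul_sum] at h
  have hperm : ∑ j, inner ℝ x (w (σ j)) = ∑ j, inner ℝ x (w j) :=
    Equiv.sum_comp σ fun j => inner ℝ x (w j)
  rw [hperm] at h
  have h2 : r m * (r m * ∑ j, inner ℝ (u m j) (w (σ j))) ≤
      r m * (r m * ∑ j, inner ℝ (u m j) (w j)) := by linarith
  exact le_of_mul_le_mul_left (le_of_mul_le_mul_left h2 (hr0 m)) (hr0 m)

/-- AM-GM inequality for a positive semidefinite symmetric map. -/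
theorem abs_det_le_trace_div_pow {n : ℕ} (hn : n ≠ 0) (D : En n →ₗ[ℝ] En n) (hD : D.IsSymmetric)
    (hpos : ∀ v, 0 ≤ inner ℝ v (D v)) :
    0 ≤ LinearMap.trace ℝ (En n) D ∧ |LinearMap.det D| ≤ (LinearMap.trace ℝ (En n) D / n) ^ n := by
  have hfr : Module.finrank ℝ (En n) = n := by simp
  have hev : ∀ i, 0 ≤ hD.eigenvalues hfr i := by
    intro i
    have h := hpos (hD.eigenvectorBasis hfr i)
    rw [hD.apply_eigenvectorBasis, inner_smul_right] at h
    simpa using h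
  have htr : LinearMap.trace ℝ (En n) D = ∑ i, hD.eigenvalues hfr i := by
    simpa using hD.trace_eq_sum_eigenvalues hfr
  have hdet : LinearMap.det D = ∏ i, hD.eigenvalues hfr i := by
    simpa using hD.det_eq_prod_eigenvalues hfr
  refine ⟨htr ▸ Finset.sum_nonneg fun i _ => hev i, ?_⟩
  rw [hdet, htr, abs_of_nonneg (Finset.prod_nonneg fun i _ => hev i)]
  have hn0 : (n : ℝ) ≠ 0 := Nat.cast_ne_zero.2 hn
  have h := Real.geom_mean_le_arith_mean_weighted Finset.univ (fun _ : Fin n => (n : ℝ)⁻¹)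
    (fun i => hD.eigenvalues hfr i) (fun _ _ => by positivity) (by simp [hn0]) (fun i _ => hev i)
  rw [Real.finsetProd_rpow _ _ fun i _ => hev i, ← Finset.mul_sum, ← div_eq_inv_mul] at h
  have h0 : 0 ≤ ∏ i, hD.eigenvalues hfr i := Finset.prod_nonneg fun i _ => hev i
  calc ∏ i, hD.eigenvalues hfr i = ((∏ i, hD.eigenvalues hfr i) ^ (n : ℝ)⁻¹) ^ n :=
        (Real.rpow_inv_natCast_pow h0 hn).symm
    _ ≤ _ := pow_le_pow_left₀ (by positivity) h n

/-- The weighted mean of a finite family of vectors. -/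
def wmean {ι E : Type*} [Fintype ι] [NormedAddCommGroup E] [InnerProductSpace ℝ E]
    (lam : ι → ℝ) (x : ι → E) : E := (∑ i, lam i)⁻¹ • ∑ i, lam i • x i

/-- The weighted variance of a finite family of vectors. -/
def wvar {ι E : Type*} [Fintype ι] [NormedAddCommGroup E] [InnerProductSpace ℝ E]
    (lam : ι → ℝ) (x : ι → E) : ℝ := ∑ i, lam i * ‖x i - wmean lam x‖ ^ 2

theorem sum_mul_norm_sq_update {ι E : Type*} [Fintype ι] [DecidableEq ι]
    [NormedAddCommGroup E] {lam : ι → ℝ} (x : ι → E) (i : ι) (y : E) :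
    ∑ k, lam k * ‖Function.update x i y k‖ ^ 2 =
      ∑ k, lam k * ‖x k‖ ^ 2 + lam i * (‖y‖ ^ 2 - ‖x i‖ ^ 2) := by
  rw [← sub_eq_iff_eq_add', ← Finset.sum_sub_distrib, Finset.sum_eq_single i]
  · simp [mul_sub]
  · intro k _ hk
    simp [hk]
  · simp

section wmean

variable {ι E : Type*} [Fintype ι] [NormedAddCommGroup E] [InnerProductSpace ℝ E] {lam : ι → ℝ}

theorem sum_smul_eq_smul_wmean (hL : ∑ i, lam i ≠ 0) (x : ι → E) :
    ∑ i, lam i • x i = (∑ i, lam i) • wmean lam x := by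
  rw [wmean, smul_smul, mul_inv_cancel₀ hL, one_smul]

/-- Huygens' identity. -/
theorem sum_mul_norm_sub_sq (hL : ∑ i, lam i ≠ 0) (x : ι → E) (z : E) :
    ∑ i, lam i * ‖x i - z‖ ^ 2 = wvar lam x + (∑ i, lam i) * ‖wmean lam x - z‖ ^ 2 := by
  have h : ∀ i, lam i * ‖x i - z‖ ^ 2 = lam i * ‖x i - wmean lam x‖ ^ 2 +
      2 * inner ℝ (lam i • x i - lam i • wmean lam x) (wmean lam x - z) +
      lam i * ‖wmean lam x - z‖ ^ 2 := fun i => by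
    rw [← sub_add_sub_cancel (x i) (wmean lam x) z, norm_add_sq_real, ← smul_sub,
      real_inner_smul_left]
    ring
  have h0 : ∑ i, (lam i • x i - lam i • wmean lam x) = 0 := by
    rw [Finset.sum_sub_distrib, sum_smul_eq_smul_wmean hL, ← Finset.sum_smul, sub_self]
  simp only [h, Finset.sum_add_distrib, ← Finset.mul_sum, ← Finset.sum_mul, ← sum_inner, h0,
    inner_zero_left, wvar]
  ring

theorem wvar_eq (hL : ∑ i, lam i ≠ 0) (x : ι → E) :
    wvar lam x = ∑ i, lam i * ‖x i‖ ^ 2 - (∑ i, lam i) * ‖wmean lam x‖ ^ 2 := by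
  have := sum_mul_norm_sub_sq hL x 0
  simp only [sub_zero] at this
  linarith

theorem wvar_le (hL : ∑ i, lam i ≠ 0) (hL0 : 0 ≤ ∑ i, lam i) (x : ι → E) (z : E) :
    wvar lam x ≤ ∑ i, lam i * ‖x i - z‖ ^ 2 := by
  rw [sum_mul_norm_sub_sq hL]
  exact le_add_of_nonneg_right (by positivity)

theorem wmean_update [DecidableEq ι] (x : ι → E) (i : ι) (y : E) :
    wmean lam (Function.update x i y) =
      wmean lam x + ((∑ i, lam i)⁻¹ * lam i) • (y - x i) := by
  have : ∑ k, lam k • Function.update x i y k = ∑ k, lam k • x k + lam i • (y - x i) := by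
    rw [← sub_eq_iff_eq_add', ← Finset.sum_sub_distrib, Finset.sum_eq_single i]
    · simp [smul_sub]
    · intro k _ hk
      simp [hk]
    · simp
  rw [wmean, this, smul_add, smul_smul, wmean]

/-- Cyclical monotonicity, for the variance cost, controls the coupling between the mean and each
of the coordinates. -/
theorem sum_inner_wmean_add_le [DecidableEq ι] (hL : 0 < ∑ i, lam i) {i : ι} (hi : 0 < lam i)
    {k : ℕ} (ω : Fin k → ι → E) (σ : Equiv.Perm (Fin k))
    (h : ∑ j, wvar lam (ω j) ≤ ∑ j, wvar lam (Function.update (ω j) i (ω (σ j) i))) :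
    ∑ j, inner ℝ (wmean lam (ω j)) (ω (σ j) i) +
      lam i / (2 * ∑ i, lam i) * ∑ j, ‖ω (σ j) i - ω j i‖ ^ 2 ≤
      ∑ j, inner ℝ (wmean lam (ω j)) (ω j i) := by
  set L := ∑ i, lam i with hLdef
  have h1 : ∀ j, wvar lam (Function.update (ω j) i (ω (σ j) i)) = wvar lam (ω j) +
      lam i * (‖ω (σ j) i‖ ^ 2 - ‖ω j i‖ ^ 2) -
      2 * lam i * (inner ℝ (wmean lam (ω j)) (ω (σ j) i) - inner ℝ (wmean lam (ω j)) (ω j i)) -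
      2 * lam i * (lam i / (2 * L) * ‖ω (σ j) i - ω j i‖ ^ 2) := fun j => by
    rw [wvar_eq hL.ne', wvar_eq hL.ne', wmean_update, sum_mul_norm_sq_update, norm_add_sq_real,
      real_inner_smul_right, norm_smul, mul_pow, inner_sub_right, Real.norm_eq_abs, sq_abs,
      ← hLdef]
    field_simp
    ring
  simp only [h1, Finset.sum_add_distrib, Finset.sum_sub_distrib, ← Finset.mul_sum] at h
  rw [Equiv.sum_comp σ fun j => ‖ω j i‖ ^ 2, sub_self, mul_zero] at h
  have : 0 ≤ 2 * lam i * (∑ j, inner ℝ (wmean lam (ω j)) (ω j i) -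
    (∑ j, inner ℝ (wmean lam (ω j)) (ω (σ j) i) +
      lam i / (2 * L) * ∑ j, ‖ω (σ j) i - ω j i‖ ^ 2)) := by linarith
  have := nonneg_of_mul_nonneg_right this (by positivity)
  linarith

/-- On a cyclically monotone set for the variance cost, each coordinate is a Lipschitz cyclically
monotone function of the mean. -/
theorem exists_maps_of_cyclicallyMonotone [DecidableEq ι] (hlam : ∀ i, 0 < lam i)
    (hL : 0 < ∑ i, lam i) (S : Set (ι → E))
    (h : ∀ (k : ℕ) (ω : Fin k → ι → E) (σ : Equiv.Perm (Fin k)) (i : ι), (∀ j, ω j ∈ S) →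
      ∑ j, wvar lam (ω j) ≤ ∑ j, wvar lam (Function.update (ω j) i (ω (σ j) i))) :
    ∃ T : ι → E → E, (∀ ω ∈ S, ∀ i, T i (wmean lam ω) = ω i) ∧
      (∀ i, LipschitzOnWith (Real.toNNReal ((∑ i, lam i) / lam i)) (T i) (wmean lam '' S)) ∧
      (∀ z ∈ wmean lam '' S, ∑ i, lam i • T i z = (∑ i, lam i) • z) ∧
      ∀ (i : ι) (k : ℕ) (p : Fin k → E) (σ : Equiv.Perm (Fin k)), (∀ j, p j ∈ wmean lam '' S) →
        ∑ j, inner ℝ (p j) (T i (p (σ j))) ≤ ∑ j, inner ℝ (p j) (T i (p j)) := by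
  have hlip : ∀ ω ∈ S, ∀ ω' ∈ S, ∀ i,
      ‖ω i - ω' i‖ ≤ (∑ i, lam i) / lam i * ‖wmean lam ω - wmean lam ω'‖ := by
    intro ω hω ω' hω' i
    have h1 := sum_inner_wmean_add_le hL (hlam i) ![ω, ω'] (Equiv.swap 0 1)
      (h 2 _ _ i (by intro j; fin_cases j <;> assumption))
    simp only [Fin.sum_univ_two, Equiv.swap_apply_left, Equiv.swap_apply_right,
      Matrix.cons_val_zero, Matrix.cons_val_one, norm_sub_rev (ω' i)] at h1
    have h2 : lam i / (∑ i, lam i) * ‖ω i - ω' i‖ ^ 2 ≤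
        inner ℝ (wmean lam ω - wmean lam ω') (ω i - ω' i) := by
      have : lam i / (2 * ∑ i, lam i) * (‖ω i - ω' i‖ ^ 2 + ‖ω i - ω' i‖ ^ 2) =
          lam i / (∑ i, lam i) * ‖ω i - ω' i‖ ^ 2 := by field_simp; ring
      rw [this] at h1
      simp only [inner_sub_left, inner_sub_right]
      linarith
    have h3 := h2.trans (real_inner_le_norm _ _)
    rcases (norm_nonneg (ω i - ω' i)).eq_or_lt with h0 | h0
    · rw [← h0]
      have := hlam i
      positivity
    · rw [div_mul_eq_mul_div, le_div_iff₀ (hlam i)]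
      have h4 : lam i / (∑ i, lam i) * ‖ω i - ω' i‖ ≤ ‖wmean lam ω - wmean lam ω'‖ := by
        refine le_of_mul_le_mul_right ?_ h0
        linarith
      rw [div_mul_eq_mul_div, div_le_iff₀ hL] at h4
      linarith
  have hex : ∀ z ∈ wmean lam '' S, ∃ ω ∈ S, wmean lam ω = z := fun z hz => hz
  choose! F hFS hF using hex
  have hT : ∀ ω ∈ S, ∀ i, F (wmean lam ω) i = ω i := by
    intro ω hω i
    have hz : wmean lam ω ∈ wmean lam '' S := mem_image_of_mem _ hω
    have := hlip _ (hFS _ hz) _ hω i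
    rw [hF _ hz, sub_self, norm_zero, mul_zero] at this
    exact sub_eq_zero.1 (norm_le_zero_iff.1 this)
  refine ⟨fun i z => F z i, hT, fun i => ?_, fun z hz => ?_, fun i k p σ hp => ?_⟩
  · refine LipschitzOnWith.of_dist_le_mul fun z hz w hw => ?_
    have := hlip _ (hFS z hz) _ (hFS w hw) i
    rw [hF z hz, hF w hw] at this
    rwa [Real.coe_toNNReal _ (div_nonneg hL.le (hlam i).le), dist_eq_norm, dist_eq_norm]
  · rw [sum_smul_eq_smul_wmean hL.ne', hF z hz]
  · have h1 := sum_inner_wmean_add_le hL (hlam i) (fun j => F (p j)) σ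
      (h k _ σ i fun j => hFS _ (hp j))
    simp only [hF _ (hp _)] at h1
    have h0 : 0 ≤ lam i / (2 * ∑ i, lam i) * ∑ j, ‖F (p (σ j)) i - F (p j) i‖ ^ 2 := by
      have := hlam i
      positivity
    linarith

end wmean

/-- At a density point, one of the derivatives has a small determinant. -/
theorem exists_abs_det_le {n : ℕ} (hn : n ≠ 0) {ι : Type*} [Fintype ι] {lam : ι → ℝ}
    (hlam : ∀ i, 0 < lam i) {s : Set (En n)} {x : En n} (hxs : x ∈ s)
    (hx : Filter.Tendsto (fun r => volume (s ∩ Metric.closedBall x r) /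
      volume (Metric.closedBall x r)) (nhdsWithin 0 (Ioi 0)) (nhds 1))
    {T : ι → En n → En n} {D : ι → En n →L[ℝ] En n}
    (hT : ∀ i, HasFDerivWithinAt (T i) (D i) s x)
    (hcyc : ∀ (i : ι) (k : ℕ) (p : Fin k → En n) (σ : Equiv.Perm (Fin k)), (∀ j, p j ∈ s) →
      ∑ j, inner ℝ (p j) (T i (p (σ j))) ≤ ∑ j, inner ℝ (p j) (T i (p j)))
    (hsum : ∀ z ∈ s, ∑ i, lam i • T i z = (∑ i, lam i) • z)
    (I : Finset ι) {m : ℝ} (hm : 0 < m) (hI : m ≤ ∑ i ∈ I, lam i) :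
    ∃ i ∈ I, |(D i).det| ≤ ((∑ i, lam i) / m) ^ n := by
  have hc : ∀ i k (v : Fin k → En n) (σ : Equiv.Perm (Fin k)),
      ∑ j, inner ℝ (v j) ((D i : En n →ₗ[ℝ] En n) (v (σ j))) ≤
        ∑ j, inner ℝ (v j) ((D i : En n →ₗ[ℝ] En n) (v j)) := fun i k v σ =>
    cyclicallyMonotone_fderivWithin hx (hT i) (hcyc i) k v σ
  have hsymm : ∀ i, (D i : En n →ₗ[ℝ] En n).IsSymmetric := fun i u v => by
    rw [real_inner_comm]
    exact inner_map_comm_of_cyclicallyMonotone _ (hc i) v u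
  have hpos : ∀ i v, 0 ≤ inner ℝ v ((D i : En n →ₗ[ℝ] En n) v) := fun i v => by
    have := hc i 2 ![v, 0] (Equiv.swap 0 1)
    simpa [Fin.sum_univ_two] using this
  have hD : ∑ i, lam i • (D i : En n →ₗ[ℝ] En n) = (∑ i, lam i) • LinearMap.id := by
    ext1 v
    obtain ⟨r, u, hr0, hr, hs, hu⟩ := exists_seq_of_density_one (k := 1) s x hx fun _ => v
    have h1 : Filter.Tendsto (fun m => ∑ i, lam i • ((r m)⁻¹ • (T i (x + r m • u m 0) - T i x)))
        Filter.atTop (nhds (∑ i, lam i • D i v)) :=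
      tendsto_finsetSum _ fun i _ =>
        (tendsto_quotient_of_hasFDerivWithinAt (hT i) hr0 hr hs hu 0).const_smul (lam i)
    have h2 : ∀ m, ∑ i, lam i • ((r m)⁻¹ • (T i (x + r m • u m 0) - T i x)) =
        (∑ i, lam i) • u m 0 := by
      intro m
      simp only [smul_comm (lam _) (r m)⁻¹, ← Finset.smul_sum, smul_sub, Finset.sum_sub_distrib,
        hsum _ (hs m 0), hsum _ hxs]
      rw [← smul_sub, ← smul_sub, add_sub_cancel_left, smul_comm (r m)⁻¹, smul_smul (r m)⁻¹,
        inv_mul_cancel₀ (hr0 m).ne', one_smul]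
    simp only [h2] at h1
    have := tendsto_nhds_unique h1 ((hu 0).const_smul (∑ i, lam i))
    simpa using this
  have htr : ∑ i, lam i * LinearMap.trace ℝ (En n) (D i : En n →ₗ[ℝ] En n) =
      (∑ i, lam i) * n := by
    have := congrArg (LinearMap.trace ℝ (En n)) hD
    simpa using this
  have hdet := fun i => abs_det_le_trace_div_pow hn _ (hsymm i) (hpos i)
  by_contra! hlt
  have hL : 0 ≤ ∑ i, lam i := Finset.sum_nonneg fun i _ => (hlam i).le
  have hn0 : (0 : ℝ) < n := by positivity
  have h1 : ∀ i ∈ I, (∑ i, lam i) / m * n <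
      LinearMap.trace ℝ (En n) (D i : En n →ₗ[ℝ] En n) := fun i hi => by
    rw [← lt_div_iff₀ hn0]
    exact lt_of_pow_lt_pow_left₀ n (div_nonneg (hdet i).1 hn0.le) ((hlt i hi).trans_le (hdet i).2)
  have hne : I.Nonempty := by
    rw [Finset.nonempty_iff_ne_empty]
    rintro rfl
    simp at hI
    linarith
  have h2 : ∑ i ∈ I, lam i * ((∑ i, lam i) / m * n) <
      ∑ i ∈ I, lam i * LinearMap.trace ℝ (En n) (D i : En n →ₗ[ℝ] En n) :=
    Finset.sum_lt_sum_of_nonempty hne fun i hi => mul_lt_mul_of_pos_left (h1 i hi) (hlam i)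
  have h3 : ∑ i ∈ I, lam i * LinearMap.trace ℝ (En n) (D i : En n →ₗ[ℝ] En n) ≤
      ∑ i, lam i * LinearMap.trace ℝ (En n) (D i : En n →ₗ[ℝ] En n) :=
    Finset.sum_le_sum_of_subset_of_nonneg (Finset.subset_univ I) fun i _ _ =>
      mul_nonneg (hlam i).le (hdet i).1
  rw [← Finset.sum_mul, htr] at *
  have h4 : (∑ i, lam i) * n = m * ((∑ i, lam i) / m * n) := by field_simp
  have h5 : m * ((∑ i, lam i) / m * n) ≤ (∑ i ∈ I, lam i) * ((∑ i, lam i) / m * n) :=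
    mul_le_mul_of_nonneg_right hI (by positivity)
  linarith

/-- Lipschitz images of null sets are null. -/
theorem volume_image_eq_zero_of_lipschitzOnWith {n : ℕ} {C : NNReal} {T : En n → En n}
    {s : Set (En n)} (hT : LipschitzOnWith C T s) (hs : volume s = 0) : volume (T '' s) = 0 := by
  have h := Measure.isAddLeftInvariant_eq_smul (volume : Measure (En n)) (Measure.hausdorffMeasure n)
  set c := Measure.addHaarScalarFactor (volume : Measure (En n)) (Measure.hausdorffMeasure n)
  have hc : c ≠ 0 := by
    intro h0
    rw [h0, zero_smul] at h
    exact NeZero.ne (volume : Measure (En n)) h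
  have h1 : Measure.hausdorffMeasure n s = 0 := by
    rw [h, Measure.smul_apply] at hs
    simpa [hc] using hs
  have h2 := hT.hausdorffMeasure_image_le (Nat.cast_nonneg n)
  rw [h1, mul_zero, nonpos_iff_eq_zero] at h2
  rw [h, Measure.smul_apply, h2, smul_zero]

/-- A measure whose mass is controlled, up to images under Lipschitz maps `T i` for which almost
everywhere at least one of the Jacobian determinants is small, has bounded density. -/
theorem measure_le_of_image_le {n : ℕ} {ι : Type*} [Finite ι] {E : Set (En n)}
    (hE : MeasurableSet E) (ν : Measure (En n)) [IsFiniteMeasure ν] (hν : ν Eᶜ = 0)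
    {T : ι → En n → En n} {L : ι → NNReal} (hT : ∀ i, LipschitzOnWith (L i) (T i) E)
    (I : Finset ι) (hI : I.Nonempty) {K C : ℝ} (hK : 0 ≤ K)
    (himg : ∀ i ∈ I, ∀ s ⊆ E, MeasurableSet s → ν s ≤ ENNReal.ofReal K * volume (T i '' s))
    (hdet : ∀ᵐ x, x ∈ E → ∀ D : ι → En n →L[ℝ] En n, (∀ i, HasFDerivWithinAt (T i) (D i) E x) →
      ∃ i ∈ I, |(D i).det| ≤ C) :
    ν ≤ ENNReal.ofReal (K * C) • volume := by
  obtain ⟨i₀, hi₀⟩ := hI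
  have hac : ν ≪ volume := by
    refine Measure.AbsolutelyContinuous.mk fun s hs hs0 => ?_
    have h1 : ν (s ∩ E) = 0 := by
      refine le_antisymm ((himg i₀ hi₀ _ inter_subset_right (hs.inter hE)).trans ?_) zero_le
      rw [volume_image_eq_zero_of_lipschitzOnWith ((hT i₀).mono inter_subset_right)
        (measure_mono_null inter_subset_left hs0), mul_zero]
    refine measure_mono_null (t := s ∩ E ∪ Eᶜ) (fun x hx => ?_) (measure_union_null h1 hν)
    by_cases hxE : x ∈ E
    · exact Or.inl ⟨hx, hxE⟩
    · exact Or.inr hxE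
  have hdiff : ∀ᵐ x : En n, x ∈ E → ∀ i, DifferentiableWithinAt ℝ (T i) E x := by
    have := ae_all_iff.2 fun i => (hT i).ae_differentiableWithinAt_of_mem (μ := volume)
    filter_upwards [this] with x hx hxE i using hx i hxE
  obtain ⟨G, hGsub, hGm, hG0⟩ := exists_measurable_superset_of_null
    (ae_iff.1 (hdiff.and hdet))
  set E' := E \ G with hE'
  have hE'm : MeasurableSet E' := hE.diff hGm
  have hGE : ∀ x ∈ E', (∀ i, DifferentiableWithinAt ℝ (T i) E x) ∧
      ∃ i ∈ I, |(fderivWithin ℝ (T i) E x).det| ≤ C := by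
    intro x hx
    have : ¬ x ∈ {a | ¬ ((a ∈ E → ∀ i, DifferentiableWithinAt ℝ (T i) E a) ∧ (a ∈ E →
        ∀ D : ι → En n →L[ℝ] En n, (∀ i, HasFDerivWithinAt (T i) (D i) E a) →
          ∃ i ∈ I, |(D i).det| ≤ C))} := fun h => hx.2 (hGsub h)
    have h2 := not_not.1 this
    exact ⟨h2.1 hx.1, h2.2 hx.1 _ fun i => (h2.1 hx.1 i).hasFDerivWithinAt⟩
  have hder : ∀ i, ∀ x ∈ E', HasFDerivWithinAt (T i) (fderivWithin ℝ (T i) E x) E' x :=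
    fun i x hx => ((hGE x hx).1 i).hasFDerivWithinAt.mono sdiff_subset
  have hwd : volume.withDensity (ν.rnDeriv volume) = ν := Measure.withDensity_rnDeriv_eq _ _ hac
  have hle : ∀ i ∈ I, ∀ᵐ x ∂(volume.restrict E'), ν.rnDeriv volume x ≤
      ENNReal.ofReal K * ENNReal.ofReal |(fderivWithin ℝ (T i) E x).det| := by
    intro i hi
    refine ae_le_of_forall_setLIntegral_le_of_sigmaFinite (Measure.measurable_rnDeriv _ _)
      fun s hs _ => ?_
    rw [Measure.restrict_restrict hs, lintegral_const_mul' _ _ ENNReal.ofReal_ne_top,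
      ← withDensity_apply _ (hs.inter hE'm), hwd]
    refine (himg i hi _ (inter_subset_right.trans sdiff_subset) (hs.inter hE'm)).trans ?_
    gcongr
    exact addHaar_image_le_lintegral_abs_det_fderiv _ (hs.inter hE'm)
      fun x hx => (hder i x hx.2).mono inter_subset_right
  have hle' : ∀ᵐ x ∂(volume.restrict E'), ν.rnDeriv volume x ≤ ENNReal.ofReal (K * C) := by
    have := (Filter.eventually_all_finset I).2 hle
    filter_upwards [this, ae_restrict_mem hE'm] with x hx hxE
    obtain ⟨i, hi, hiC⟩ := (hGE x hxE).2
    refine (hx i hi).trans ?_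
    rw [← ENNReal.ofReal_mul hK]
    gcongr
  refine Measure.le_iff.2 fun s hs => ?_
  have h0 : ν (s \ E') = 0 := by
    refine measure_mono_null (t := Eᶜ ∪ G) (fun x hx => ?_)
      (measure_union_null hν (hac hG0))
    by_cases hxE : x ∈ E
    · by_contra h
      exact hx.2 ⟨hxE, fun hxG => h (Or.inr hxG)⟩
    · exact Or.inl hxE
  calc ν s ≤ ν (s ∩ E') := by
        rw [← measure_inter_add_sdiff s hE'm, h0, add_zero]
    _ = ∫⁻ x in s ∩ E', ν.rnDeriv volume x := by
        rw [← withDensity_apply _ (hs.inter hE'm), hwd]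
    _ ≤ ∫⁻ x in s ∩ E', ENNReal.ofReal (K * C) := by
        refine lintegral_mono_ae ?_
        rw [← Measure.restrict_restrict hs]
        exact ae_restrict_of_ae hle'
    _ = ENNReal.ofReal (K * C) * volume (s ∩ E') := by simp
    _ ≤ ENNReal.ofReal (K * C) * volume s := by gcongr; exact inter_subset_left
    _ = _ := by simp

/-- The mean of an optimal multimarginal plan has a bounded density. -/
theorem map_wmean_le {n : ℕ} (hn : n ≠ 0) {ι : Type*} [Fintype ι] {R : ℝ} {lam : ι → ℝ}
    (hlam : ∀ i, 0 < lam i) (γ : Measure (ι → Metric.closedBall (0 : En n) R))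
    [IsProbabilityMeasure γ]
    (hopt : ∀ γ' : Measure (ι → Metric.closedBall (0 : En n) R), IsProbabilityMeasure γ' →
      (∀ i, γ'.map (Function.eval i) = γ.map (Function.eval i)) →
      ∫ x, wvar lam (fun i => (x i : En n)) ∂γ ≤ ∫ x, wvar lam (fun i => (x i : En n)) ∂γ')
    (I : Finset ι) {K m : ℝ} (hK : 0 ≤ K) (hm : 0 < m) (hmI : m ≤ ∑ i ∈ I, lam i)
    (hI : ∀ i ∈ I, γ.map (fun x => (x i : En n)) ≤ ENNReal.ofReal K • volume) :
    γ.map (fun x => wmean lam fun i => (x i : En n)) ≤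
      ENNReal.ofReal (K * ((∑ i, lam i) / m) ^ n) • volume := by
  classical
  have hne : I.Nonempty := by
    rw [Finset.nonempty_iff_ne_empty]
    rintro rfl
    simp at hmI
    linarith
  have hL : 0 < ∑ i, lam i :=
    (hm.trans_le hmI).trans_le (Finset.sum_le_sum_of_subset_of_nonneg (Finset.subset_univ I)
      fun i _ _ => (hlam i).le)
  have hcm : Continuous fun x : ι → Metric.closedBall (0 : En n) R =>
      wmean lam fun i => (x i : En n) := by
    unfold wmean
    fun_prop
  have hc : Continuous fun x : ι → Metric.closedBall (0 : En n) R =>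
      wvar lam fun i => (x i : En n) := by
    unfold wvar
    fun_prop
  set S : Set (ι → En n) := (fun x i => (x i : En n)) '' γ.support with hS
  have hsupp : wmean lam '' S = (fun x : ι → Metric.closedBall (0 : En n) R =>
      wmean lam fun i => (x i : En n)) '' γ.support := by
    rw [hS, image_image]
  obtain ⟨T, hT, hlip, hsum, hcyc⟩ := exists_maps_of_cyclicallyMonotone hlam hL S (by
    intro k ω σ i hω
    choose x hx hxω using hω
    have h := sum_cost_le_sum_cost_update hc γ hopt x hx σ i
    have h1 : ∀ j, (fun i' => (Function.update (x j) i (x (σ j) i) i' : En n)) =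
        Function.update (ω j) i (ω (σ j) i) := by
      intro j
      ext1 i'
      rw [← hxω j, ← hxω (σ j)]
      rcases eq_or_ne i' i with rfl | hne
      · simp
      · simp [hne]
    simpa only [h1, hxω] using h)
  have hcpt : IsCompact (wmean lam '' S) := by
    rw [hsupp]
    exact (Measure.isClosed_support.isCompact).image hcm
  have hsuppnull : γ γ.supportᶜ = 0 := Measure.measure_compl_support
  have : IsProbabilityMeasure (γ.map (fun x => wmean lam fun i => (x i : En n))) :=
    Measure.isProbabilityMeasure_map hcm.aemeasurable
  refine measure_le_of_image_le hcpt.measurableSet _ ?_ hlip I hne hK ?_ ?_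
  · rw [Measure.map_apply hcm.measurable hcpt.measurableSet.compl]
    refine measure_mono_null (t := γ.supportᶜ) (fun x hx hxs => hx ?_) hsuppnull
    rw [hsupp]
    exact mem_image_of_mem _ hxs
  · intro i hi s hsE hs
    rw [Measure.map_apply hcm.measurable hs]
    have hmeas : Measurable fun x : ι → Metric.closedBall (0 : En n) R => (x i : En n) :=
      (measurable_pi_apply i).subtype_val
    calc γ ((fun x => wmean lam fun i => (x i : En n)) ⁻¹' s)
        ≤ γ ((fun x => (x i : En n)) ⁻¹' (T i '' s) ∪ γ.supportᶜ) := by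
          refine measure_mono fun x hx => ?_
          by_cases hxs : x ∈ γ.support
          · exact Or.inl ⟨_, hx, hT _ (mem_image_of_mem _ hxs) i⟩
          · exact Or.inr hxs
      _ ≤ γ ((fun x => (x i : En n)) ⁻¹' (T i '' s)) := by
          simpa [hsuppnull] using
            measure_union_le (μ := γ) ((fun x => (x i : En n)) ⁻¹' (T i '' s)) γ.supportᶜ
      _ ≤ γ.map (fun x => (x i : En n)) (T i '' s) := Measure.le_map_apply hmeas.aemeasurable _
      _ ≤ ENNReal.ofReal K * volume (T i '' s) := by simpa using hI i hi (T i '' s)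
  · filter_upwards [(ae_restrict_iff' hcpt.measurableSet).1
      (Besicovitch.ae_tendsto_measure_inter_div volume (wmean lam '' S))] with x hx hxE D hD
    exact exists_abs_det_le hn hlam hxE (hx hxE) hD hcyc hsum I hm hmI

/-- Finitely many couplings sharing a marginal can be glued along this marginal. -/
theorem exists_gluing {ι Z X : Type*} [Fintype ι] [MeasurableSpace Z] [MeasurableSpace X]
    [StandardBorelSpace X] [Nonempty X] (ν : Measure Z) [IsProbabilityMeasure ν]
    (γ : ι → Measure (Z × X)) (hγ : ∀ i, (γ i).map Prod.fst = ν) :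
    ∃ Γ : Measure (Z × (ι → X)), IsProbabilityMeasure Γ ∧ Γ.map Prod.fst = ν ∧
      ∀ i, Γ.map (fun p => (p.1, p.2 i)) = γ i := by
  classical
  have hp : ∀ i, IsProbabilityMeasure (γ i) := fun i => by
    refine ⟨?_⟩
    have := congrArg (fun m => m univ) (hγ i)
    simpa [Measure.map_apply measurable_fst MeasurableSet.univ] using this
  let κ : ProbabilityTheory.Kernel Z (ι → X) :=
    { toFun := fun z => Measure.pi fun i => (γ i).condKernel z
      measurable' := by
        refine Measurable.measure_of_isPiSystem_of_isProbabilityMeasure generateFrom_pi.symm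
          isPiSystem_pi ?_
        rintro _ ⟨t, ht, rfl⟩
        simp only [Measure.pi_pi]
        exact Finset.measurable_prod _ fun i _ =>
          ProbabilityTheory.Kernel.measurable_coe _ (ht i (mem_univ i)) }
  have hκ : ProbabilityTheory.IsMarkovKernel κ := ⟨fun z => by
    change IsProbabilityMeasure (Measure.pi fun i => (γ i).condKernel z)
    infer_instance⟩
  refine ⟨ν.compProd κ, inferInstance, Measure.fst_compProd ν κ, fun i => ?_⟩
  have h1 : κ.map (Function.eval i) = (γ i).condKernel := by
    ext1 z
    rw [ProbabilityTheory.Kernel.map_apply _ (measurable_pi_apply i)]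
    exact (measurePreserving_eval (fun i => (γ i).condKernel z) i).map_eq
  have h2 := Measure.compProd_map (μ := ν) (κ := κ) (measurable_pi_apply i)
  have h3 : (γ i).fst = ν := hγ i
  calc _ = (ν.compProd κ).map (Prod.map id (Function.eval i)) := rfl
    _ = ν.compProd (κ.map (Function.eval i)) := h2.symm
    _ = (γ i).fst.compProd (γ i).condKernel := by rw [h1, h3]
    _ = γ i := Measure.disintegrate _ _

section W2sq

variable {n : ℕ} {μ ν ρ : Measure (En n)} {γ : Measure (En n × En n)}

theorem IsCoupling.isProbabilityMeasure [IsProbabilityMeasure μ] (h : IsCoupling γ μ ν) :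
    IsProbabilityMeasure γ := by
  refine ⟨?_⟩
  have := congrArg (fun m => m univ) h.1
  simpa [Measure.map_apply measurable_fst MeasurableSet.univ] using this

theorem IsCoupling.swap (h : IsCoupling γ μ ν) : IsCoupling (γ.map Prod.swap) ν μ := by
  constructor
  · rw [Measure.map_map measurable_fst measurable_swap]
    exact h.2
  · rw [Measure.map_map measurable_snd measurable_swap]
    exact h.1

theorem integral_swap_cost : ∫ p, ‖p.1 - p.2‖ ^ 2 ∂(γ.map Prod.swap) = ∫ p, ‖p.1 - p.2‖ ^ 2 ∂γ := by
  rw [integral_map measurable_swap.aemeasurable (by fun_prop)]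
  simp only [Prod.fst_swap, Prod.snd_swap, norm_sub_rev]

theorem isCoupling_prod [IsProbabilityMeasure μ] [IsProbabilityMeasure ν] :
    IsCoupling (μ.prod ν) μ ν := by
  constructor
  · simp
  · simp

theorem IsCoupling.of_map {α : Type*} [MeasurableSpace α] (Γ : Measure α) {f g : α → En n}
    (hf : Measurable f) (hg : Measurable g) :
    IsCoupling (Γ.map fun x => (f x, g x)) (Γ.map f) (Γ.map g) := by
  constructor
  · rw [Measure.map_map measurable_fst (hf.prodMk hg)]
    rfl
  · rw [Measure.map_map measurable_snd (hf.prodMk hg)]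
    rfl

theorem bddBelow_cost : BddBelow { c | ∃ γ : Measure (En n × En n), IsCoupling γ μ ν ∧
    c = ∫ p, ‖p.1 - p.2‖ ^ 2 ∂γ } := by
  refine ⟨0, ?_⟩
  rintro _ ⟨γ, -, rfl⟩
  positivity

theorem W2sq_nonneg : 0 ≤ W2sq μ ν := by
  refine Real.sInf_nonneg ?_
  rintro _ ⟨γ, -, rfl⟩
  positivity

theorem W2sq_le (h : IsCoupling γ μ ν) : W2sq μ ν ≤ ∫ p, ‖p.1 - p.2‖ ^ 2 ∂γ :=
  csInf_le bddBelow_cost ⟨γ, h, rfl⟩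

theorem W2sq_map_le {α : Type*} [MeasurableSpace α] (Γ : Measure α) {f g : α → En n}
    (hf : Measurable f) (hg : Measurable g) :
    W2sq (Γ.map f) (Γ.map g) ≤ ∫ x, ‖f x - g x‖ ^ 2 ∂Γ := by
  refine (W2sq_le (IsCoupling.of_map Γ hf hg)).trans_eq ?_
  rw [integral_map (hf.prodMk hg).aemeasurable (by fun_prop)]

theorem exists_coupling_lt [IsProbabilityMeasure μ] [IsProbabilityMeasure ν] {e : ℝ} (he : 0 < e) :
    ∃ γ, IsCoupling γ μ ν ∧ ∫ p, ‖p.1 - p.2‖ ^ 2 ∂γ < W2sq μ ν + e := by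
  obtain ⟨_, ⟨γ, hγ, rfl⟩, h⟩ := exists_lt_of_csInf_lt
    (s := { c | ∃ γ : Measure (En n × En n), IsCoupling γ μ ν ∧ c = ∫ p, ‖p.1 - p.2‖ ^ 2 ∂γ })
    ⟨_, _, isCoupling_prod, rfl⟩ (lt_add_of_pos_right _ he)
  exact ⟨γ, hγ, h⟩

theorem W2sq_comm : W2sq μ ν = W2sq ν μ := by
  refine congrArg sInf (Set.ext fun c => ⟨?_, ?_⟩)
  · rintro ⟨γ, hγ, rfl⟩
    exact ⟨_, hγ.swap, integral_swap_cost.symm⟩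
  · rintro ⟨γ, hγ, rfl⟩
    exact ⟨_, hγ.swap, integral_swap_cost.symm⟩

theorem integrable_norm_sub_sq {α : Type*} [MeasurableSpace α] {Γ : Measure α} {f g : α → En n}
    (hf : Measurable f) (hg : Measurable g) (hf2 : FinSecMom (Γ.map f))
    (hg2 : FinSecMom (Γ.map g)) : Integrable (fun x => ‖f x - g x‖ ^ 2) Γ := by
  have h1 : Integrable (fun x => ‖f x‖ ^ 2) Γ :=
    (integrable_map_measure (by fun_prop) hf.aemeasurable).1 hf2
  have h2 : Integrable (fun x => ‖g x‖ ^ 2) Γ :=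
    (integrable_map_measure (by fun_prop) hg.aemeasurable).1 hg2
  refine Integrable.mono' ((h1.const_mul 2).add (h2.const_mul 2)) (by fun_prop) ?_
  refine Filter.Eventually.of_forall fun x => ?_
  rw [Real.norm_of_nonneg (by positivity)]
  have := norm_sub_le (f x) (g x)
  simp only [Pi.add_apply]
  nlinarith [norm_nonneg (f x - g x), sq_nonneg (‖f x‖ - ‖g x‖)]

theorem FinSecMom.of_compl_closedBall [IsFiniteMeasure μ] {R : ℝ}
    (h : μ (Metric.closedBall 0 R)ᶜ = 0) : FinSecMom μ := by
  refine Integrable.of_bound (by fun_prop) (R ^ 2) ?_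
  filter_upwards [measure_eq_zero_iff_ae_notMem.1 h] with x hx
  have hx : ‖x‖ ≤ R := by simpa using hx
  rw [Real.norm_of_nonneg (by positivity)]
  gcongr

theorem W2sq_le_of_compl_closedBall [IsProbabilityMeasure μ] [IsProbabilityMeasure ν] {R : ℝ}
    (hμ : μ (Metric.closedBall 0 R)ᶜ = 0) (hν : ν (Metric.closedBall 0 R)ᶜ = 0) :
    W2sq μ ν ≤ (2 * R) ^ 2 := by
  refine (W2sq_le isCoupling_prod).trans ?_
  have h1 : ∀ᵐ p ∂(μ.prod ν), ‖p.1‖ ≤ R := by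
    have h : ∀ᵐ x ∂μ, ‖x‖ ≤ R := by
      filter_upwards [measure_eq_zero_iff_ae_notMem.1 hμ] with x hx
      simpa using hx
    exact (Measure.quasiMeasurePreserving_fst (μ := μ) (ν := ν)).ae h
  have h2 : ∀ᵐ p ∂(μ.prod ν), ‖p.2‖ ≤ R := by
    have h : ∀ᵐ x ∂ν, ‖x‖ ≤ R := by
      filter_upwards [measure_eq_zero_iff_ae_notMem.1 hν] with x hx
      simpa using hx
    exact (Measure.quasiMeasurePreserving_snd (μ := μ) (ν := ν)).ae h
  have : ∫ p, ‖p.1 - p.2‖ ^ 2 ∂(μ.prod ν) ≤ ∫ _p, (2 * R) ^ 2 ∂(μ.prod ν) := by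
    refine integral_mono_of_nonneg (Filter.Eventually.of_forall fun p => by positivity)
      (integrable_const _) ?_
    filter_upwards [h1, h2] with p hp1 hp2
    have := norm_sub_le p.1 p.2
    exact pow_le_pow_left₀ (norm_nonneg _) (by linarith) 2
  simpa using this

theorem W2sq_le_add_mul [IsProbabilityMeasure μ] [IsProbabilityMeasure ν] [IsProbabilityMeasure ρ]
    (hμ : FinSecMom μ) (hν : FinSecMom ν) (hρ : FinSecMom ρ) {η : ℝ} (hη : 0 < η) :
    W2sq μ ν ≤ (1 + η) * W2sq μ ρ + (1 + η⁻¹) * W2sq ρ ν := by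
  refine le_of_forall_pos_le_add fun e he => ?_
  have he' : 0 < e / (2 + η + η⁻¹) := by positivity
  obtain ⟨α, hα, hα'⟩ := exists_coupling_lt (μ := ρ) (ν := μ) he'
  obtain ⟨β, hβ, hβ'⟩ := exists_coupling_lt (μ := ρ) (ν := ν) he'
  obtain ⟨Γ, hΓ, hΓ1, hΓ2⟩ := exists_gluing ρ ![α, β] (by
    intro i
    fin_cases i
    · exact hα.1
    · exact hβ.1)
  have hm0 : Measurable fun p : En n × (Fin 2 → En n) => p.2 0 := by fun_prop
  have hm1 : Measurable fun p : En n × (Fin 2 → En n) => p.2 1 := by fun_prop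
  have hΓα : Γ.map (fun p => (p.1, p.2 0)) = α := hΓ2 0
  have hΓβ : Γ.map (fun p => (p.1, p.2 1)) = β := hΓ2 1
  have hΓμ : Γ.map (fun p => p.2 0) = μ := by
    rw [← hα.2, ← hΓα, Measure.map_map measurable_snd (measurable_fst.prodMk hm0)]
    rfl
  have hΓν : Γ.map (fun p => p.2 1) = ν := by
    rw [← hβ.2, ← hΓβ, Measure.map_map measurable_snd (measurable_fst.prodMk hm1)]
    rfl
  have hcα : ∫ p, ‖p.1 - p.2‖ ^ 2 ∂α = ∫ p, ‖p.1 - p.2 0‖ ^ 2 ∂Γ := by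
    rw [← hΓα, integral_map (measurable_fst.prodMk hm0).aemeasurable (by fun_prop)]
  have hcβ : ∫ p, ‖p.1 - p.2‖ ^ 2 ∂β = ∫ p, ‖p.1 - p.2 1‖ ^ 2 ∂Γ := by
    rw [← hΓβ, integral_map (measurable_fst.prodMk hm1).aemeasurable (by fun_prop)]
  have hi0 := integrable_norm_sub_sq (Γ := Γ) measurable_fst hm0 (by rwa [hΓ1]) (by rwa [hΓμ])
  have hi1 := integrable_norm_sub_sq (Γ := Γ) measurable_fst hm1 (by rwa [hΓ1]) (by rwa [hΓν])
  have hle : W2sq μ ν ≤ ∫ p, ‖p.2 0 - p.2 1‖ ^ 2 ∂Γ := by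
    have := W2sq_map_le Γ hm0 hm1
    rwa [hΓμ, hΓν] at this
  have hle2 : ∫ p, ‖p.2 0 - p.2 1‖ ^ 2 ∂Γ ≤
      ∫ p, ((1 + η) * ‖p.1 - p.2 0‖ ^ 2 + (1 + η⁻¹) * ‖p.1 - p.2 1‖ ^ 2) ∂Γ := by
    refine integral_mono_of_nonneg (Filter.Eventually.of_forall fun p => by positivity)
      ((hi0.const_mul _).add (hi1.const_mul _)) (Filter.Eventually.of_forall fun p => ?_)
    have h1 : ‖p.2 0 - p.2 1‖ ≤ ‖p.1 - p.2 0‖ + ‖p.1 - p.2 1‖ := by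
      have := norm_sub_le (p.1 - p.2 1) (p.1 - p.2 0)
      rw [sub_sub_sub_cancel_left] at this
      linarith
    have h2 : (1 + η) * ‖p.1 - p.2 0‖ ^ 2 + (1 + η⁻¹) * ‖p.1 - p.2 1‖ ^ 2 =
        (‖p.1 - p.2 0‖ + ‖p.1 - p.2 1‖) ^ 2 +
          η⁻¹ * (η * ‖p.1 - p.2 0‖ - ‖p.1 - p.2 1‖) ^ 2 := by
      field_simp
      ring
    have h3 : 0 ≤ η⁻¹ * (η * ‖p.1 - p.2 0‖ - ‖p.1 - p.2 1‖) ^ 2 := by positivity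
    simp only
    rw [h2]
    nlinarith [norm_nonneg (p.2 0 - p.2 1)]
  rw [integral_add (hi0.const_mul _) (hi1.const_mul _), integral_const_mul, integral_const_mul,
    ← hcα, ← hcβ] at hle2
  rw [W2sq_comm (μ := μ) (ν := ρ)]
  have hη' : 0 < η⁻¹ := inv_pos.2 hη
  have h4 : (1 + η) * (e / (2 + η + η⁻¹)) + (1 + η⁻¹) * (e / (2 + η + η⁻¹)) = e := by
    field_simp
    ring
  nlinarith

/-- The triangle inequality for the Wasserstein distance. -/
theorem sqrt_W2sq_triangle [IsProbabilityMeasure μ] [IsProbabilityMeasure ν]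
    [IsProbabilityMeasure ρ] (hμ : FinSecMom μ) (hν : FinSecMom ν) (hρ : FinSecMom ρ) :
    √(W2sq μ ν) ≤ √(W2sq μ ρ) + √(W2sq ρ ν) := by
  refine le_of_forall_pos_le_add fun e he => ?_
  set a := √(W2sq μ ρ) + e / 2 with ha
  set b := √(W2sq ρ ν) + e / 2 with hb
  have ha0 : 0 < a := by positivity
  have hb0 : 0 < b := by positivity
  have h1 := W2sq_le_add_mul hμ hν hρ (div_pos hb0 ha0)
  have h2 : W2sq μ ρ ≤ a ^ 2 := by
    rw [← Real.sq_sqrt (W2sq_nonneg (μ := μ) (ν := ρ))]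
    exact pow_le_pow_left₀ (Real.sqrt_nonneg _) (by linarith) 2
  have h3 : W2sq ρ ν ≤ b ^ 2 := by
    rw [← Real.sq_sqrt (W2sq_nonneg (μ := ρ) (ν := ν))]
    exact pow_le_pow_left₀ (Real.sqrt_nonneg _) (by linarith) 2
  have h4 : W2sq μ ν ≤ (a + b) ^ 2 := by
    calc W2sq μ ν ≤ (1 + b / a) * a ^ 2 + (1 + (b / a)⁻¹) * b ^ 2 := by
          refine h1.trans ?_
          gcongr
      _ = (a + b) ^ 2 := by field_simp; ring
  calc √(W2sq μ ν) ≤ a + b := Real.sqrt_le_iff.2 ⟨by positivity, h4⟩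
    _ = _ := by rw [ha, hb]; ring

theorem abs_sqrt_W2sq_sub_le [IsProbabilityMeasure μ] [IsProbabilityMeasure ν]
    [IsProbabilityMeasure ρ] (hμ : FinSecMom μ) (hν : FinSecMom ν) (hρ : FinSecMom ρ) :
    |√(W2sq μ ρ) - √(W2sq ν ρ)| ≤ √(W2sq μ ν) := by
  rw [abs_le]
  have h1 := sqrt_W2sq_triangle hμ hρ hν
  have h2 := sqrt_W2sq_triangle hν hρ hμ
  rw [W2sq_comm (μ := ν) (ν := μ)] at h2
  constructor <;> linarith

end W2sq

/-- The metric projection onto the closed ball of radius `R` centred at the origin. -/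
def ballProj {n : ℕ} (R : ℝ) (x : En n) : En n := (R / max R ‖x‖) • x

section ballProj

variable {n : ℕ} {R : ℝ}

theorem continuous_ballProj (hR : 0 < R) : Continuous (ballProj R : En n → En n) := by
  unfold ballProj
  refine Continuous.smul (Continuous.div continuous_const (continuous_const.max continuous_norm)
    fun x => ?_) continuous_id
  exact (lt_max_of_lt_left hR).ne'

theorem ballProj_eq_self (hR : 0 < R) {x : En n} (hx : ‖x‖ ≤ R) : ballProj R x = x := by
  rw [ballProj, max_eq_left hx, div_self hR.ne', one_smul]

theorem norm_ballProj_le (hR : 0 < R) (x : En n) : ‖ballProj R x‖ ≤ R := by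
  have h : 0 < max R ‖x‖ := lt_max_of_lt_left hR
  rw [ballProj, norm_smul, Real.norm_of_nonneg (by positivity), div_mul_eq_mul_div,
    div_le_iff₀ h]
  exact mul_le_mul_of_nonneg_left (le_max_right _ _) hR.le

theorem ballProj_mem (hR : 0 < R) (x : En n) : ballProj R x ∈ Metric.closedBall (0 : En n) R := by
  simpa using norm_ballProj_le hR x

theorem norm_sub_ballProj_add_le (hR : 0 < R) {x : En n} (hx : ‖x‖ ≤ R) (y : En n) :
    ‖x - ballProj R y‖ ^ 2 + ‖y - ballProj R y‖ ^ 2 ≤ ‖x - y‖ ^ 2 := by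
  rcases le_total ‖y‖ R with hy | hy
  · simp [ballProj_eq_self hR hy]
  · have hy0 : 0 < ‖y‖ := hR.trans_le hy
    have hP : ballProj R y = (R / ‖y‖) • y := by rw [ballProj, max_eq_right hy]
    have h1 : y - ballProj R y = (1 - R / ‖y‖) • y := by rw [hP, sub_smul, one_smul]
    have h2 : inner ℝ (x - ballProj R y) (y - ballProj R y) ≤ 0 := by
      rw [h1, real_inner_smul_right, inner_sub_left, hP, real_inner_smul_left,
        real_inner_self_eq_norm_sq]
      refine mul_nonpos_of_nonneg_of_nonpos (sub_nonneg.2 ((div_le_one hy0).2 hy)) ?_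
      have h3 := real_inner_le_norm x y
      have h4 : R / ‖y‖ * ‖y‖ ^ 2 = R * ‖y‖ := by field_simp
      rw [h4]
      nlinarith
    have h5 : x - y = (x - ballProj R y) - (y - ballProj R y) := by abel
    rw [h5, norm_sub_sq_real (x - ballProj R y)]
    linarith

end ballProj

/-- The law of a map into a closed ball. -/
theorem map_val_map_ballProj {n : ℕ} {R : ℝ} (hR : 0 < R) {μ : Measure (En n)}
    (hμ : μ (Metric.closedBall 0 R)ᶜ = 0) :
    (μ.map fun x => (⟨ballProj R x, ballProj_mem hR x⟩ : Metric.closedBall (0 : En n) R)).map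
      Subtype.val = μ := by
  have hm : Measurable fun x : En n =>
      (⟨ballProj R x, ballProj_mem hR x⟩ : Metric.closedBall (0 : En n) R) :=
    (continuous_ballProj hR).measurable.subtype_mk
  rw [Measure.map_map measurable_subtype_coe hm]
  have : (Subtype.val ∘ fun x : En n =>
      (⟨ballProj R x, ballProj_mem hR x⟩ : Metric.closedBall (0 : En n) R)) =ᵐ[μ] id := by
    filter_upwards [measure_eq_zero_iff_ae_notMem.1 hμ] with x hx
    exact ballProj_eq_self hR (by simpa using hx)
  rw [Measure.map_congr this, Measure.map_id]

/-- A finite family of measures on a ball has an approximate barycenter whose density is bounded. -/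
theorem exists_wmean_measure {n : ℕ} (hn : n ≠ 0) {ι : Type*} [Fintype ι] {R : ℝ} (hR : 0 < R)
    {lam : ι → ℝ} (hlam : ∀ i, 0 < lam i) (μ : ι → Measure (En n))
    [∀ i, IsProbabilityMeasure (μ i)] (hμ : ∀ i, μ i (Metric.closedBall 0 R)ᶜ = 0)
    (ρ : Measure (En n)) [IsProbabilityMeasure ρ] (hρ : ρ (Metric.closedBall 0 R)ᶜ = 0)
    (I : Finset ι) {K m : ℝ} (hK : 0 ≤ K) (hm : 0 < m) (hmI : m ≤ ∑ i ∈ I, lam i)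
    (hI : ∀ i ∈ I, μ i ≤ ENNReal.ofReal K • volume) :
    ∃ ν : Measure (En n), IsProbabilityMeasure ν ∧ ν (Metric.closedBall 0 R)ᶜ = 0 ∧
      ν ≤ ENNReal.ofReal (K * ((∑ i, lam i) / m) ^ n) • volume ∧
      ∑ i, lam i * W2sq (μ i) ν ≤ ∑ i, lam i * W2sq ρ (μ i) := by
  have hL : 0 < ∑ i, lam i :=
    (hm.trans_le hmI).trans_le (Finset.sum_le_sum_of_subset_of_nonneg (Finset.subset_univ I)
      fun i _ _ => (hlam i).le)
  let X := Metric.closedBall (0 : En n) R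
  let P : En n → X := fun x => ⟨ballProj R x, ballProj_mem hR x⟩
  have hPm : Measurable P := (continuous_ballProj hR).measurable.subtype_mk
  let M : (ι → X) → En n := fun x => wmean lam fun i => (x i : En n)
  have hMc : Continuous M := by
    unfold M wmean
    fun_prop
  let c : (ι → X) → ℝ := fun x => wvar lam fun i => (x i : En n)
  have hc : Continuous c := by
    unfold c wvar wmean
    fun_prop
  have hev : ∀ i, Measurable fun x : ι → X => (x i : En n) := fun i =>
    (measurable_pi_apply i).subtype_val
  have hκp : ∀ i, IsProbabilityMeasure ((μ i).map P) := fun i =>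
    Measure.isProbabilityMeasure_map hPm.aemeasurable
  obtain ⟨γ, hγp, hγ, hopt⟩ := exists_optimal_multimarginal_plan (fun i => (μ i).map P) c hc
  have hγμ : ∀ i, γ.map (fun x => (x i : En n)) = μ i := fun i => by
    have h := Measure.map_map (μ := γ) (measurable_subtype_coe (p := (· ∈ X)))
      (measurable_pi_apply i)
    rw [show γ.map (fun x : ι → X => x i) = (μ i).map P from hγ i,
      map_val_map_ballProj hR (hμ i)] at h
    exact h.symm
  have hint : ∀ i, Integrable (fun x => ‖(x i : En n) - M x‖ ^ 2) γ := fun i =>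
    (by fun_prop : Continuous fun x : ι → X => ‖(x i : En n) - M x‖ ^ 2)
      |>.integrable_of_hasCompactSupport (HasCompactSupport.of_compactSpace _)
  refine ⟨γ.map M, Measure.isProbabilityMeasure_map hMc.aemeasurable, ?_, ?_, ?_⟩
  · rw [Measure.map_apply hMc.measurable Metric.isClosed_closedBall.measurableSet.compl]
    convert measure_empty (μ := γ)
    refine eq_empty_of_forall_notMem fun x hx => hx ?_
    change wmean lam (fun i => (x i : En n)) ∈ Metric.closedBall (0 : En n) R
    rw [wmean, Finset.smul_sum]
    simp only [smul_smul]
    refine (convex_closedBall (0 : En n) R).sum_mem (fun i _ => ?_) ?_ fun i _ => (x i).2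
    · have := hlam i
      positivity
    · rw [← Finset.mul_sum, inv_mul_cancel₀ hL.ne']
  · exact map_wmean_le hn hlam γ (fun γ' h1 h2 => hopt γ' h1 fun i => (h2 i).trans (hγ i))
      I hK hm hmI fun i hi => (hγμ i).trans_le (hI i hi)
  · have h1 : ∑ i, lam i * W2sq (μ i) (γ.map M) ≤ ∫ x, c x ∂γ := by
      have h2 : ∫ x, c x ∂γ = ∑ i, lam i * ∫ x, ‖(x i : En n) - M x‖ ^ 2 ∂γ := by
        simp only [← integral_const_mul]
        rw [← integral_finsetSum _ fun i _ => (hint i).const_mul _]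
        rfl
      rw [h2]
      refine Finset.sum_le_sum fun i _ => mul_le_mul_of_nonneg_left ?_ (hlam i).le
      have := W2sq_map_le γ (hev i) hMc.measurable
      rwa [hγμ] at this
    refine h1.trans (le_of_forall_pos_le_add fun e he => ?_)
    have he' : 0 < e / ∑ i, lam i := by positivity
    have hex : ∀ i, ∃ α, IsCoupling α ρ (μ i) ∧
        ∫ p, ‖p.1 - p.2‖ ^ 2 ∂α < W2sq ρ (μ i) + e / ∑ i, lam i := fun i =>
      exists_coupling_lt he'
    choose α hα hαlt using hex
    obtain ⟨Γ, hΓp, hΓ1, hΓ2⟩ := exists_gluing ρ α fun i => (hα i).1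
    let Q : En n × (ι → En n) → ι → X := fun p i => P (p.2 i)
    have hQm : Measurable Q :=
      measurable_pi_lambda _ fun i => hPm.comp ((measurable_pi_apply i).comp measurable_snd)
    have hm2 : ∀ i, Measurable fun p : En n × (ι → En n) => (p.1, p.2 i) := fun i => by fun_prop
    have hΓμ : ∀ i, Γ.map (fun p => p.2 i) = μ i := fun i => by
      rw [← (hα i).2, ← hΓ2 i, Measure.map_map measurable_snd (hm2 i)]
      rfl
    have hQp : IsProbabilityMeasure (Γ.map Q) := Measure.isProbabilityMeasure_map hQm.aemeasurable
    have hQμ : ∀ i, (Γ.map Q).map (Function.eval i) = (μ i).map P := fun i => by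
      have h5 : Measurable fun p : En n × (ι → En n) => p.2 i :=
        (measurable_pi_apply i).comp measurable_snd
      rw [Measure.map_map (measurable_pi_apply i) hQm, ← hΓμ i, Measure.map_map hPm h5]
      rfl
    have h3 := hopt (Γ.map Q) hQp hQμ
    rw [integral_map hQm.aemeasurable hc.measurable.aestronglyMeasurable] at h3
    have hcost : ∀ i, ∫ p, ‖p.1 - p.2‖ ^ 2 ∂(α i) = ∫ p, ‖p.1 - p.2 i‖ ^ 2 ∂Γ := fun i => by
      rw [← hΓ2 i, integral_map (hm2 i).aemeasurable (by fun_prop)]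
    have hii : ∀ i, Integrable (fun p : En n × (ι → En n) => ‖p.1 - p.2 i‖ ^ 2) Γ := fun i =>
      integrable_norm_sub_sq measurable_fst (by fun_prop)
        (by rw [hΓ1]; exact FinSecMom.of_compl_closedBall hρ)
        (by rw [hΓμ]; exact FinSecMom.of_compl_closedBall (hμ i))
    have hΓball : ∀ᵐ p ∂Γ, ∀ i, ‖p.2 i‖ ≤ R := by
      refine ae_all_iff.2 fun i => ?_
      have h : ∀ᵐ x ∂(Γ.map fun p => p.2 i), ‖x‖ ≤ R := by
        rw [hΓμ i]
        filter_upwards [measure_eq_zero_iff_ae_notMem.1 (hμ i)] with x hx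
        simpa using hx
      exact ae_of_ae_map (by fun_prop) h
    calc ∫ x, c x ∂γ ≤ ∫ p, c (Q p) ∂Γ := h3
      _ ≤ ∫ p, ∑ i, lam i * ‖p.1 - p.2 i‖ ^ 2 ∂Γ := by
          refine integral_mono_of_nonneg (Filter.Eventually.of_forall fun p => ?_)
            (integrable_finsetSum _ fun i _ => (hii i).const_mul _) ?_
          · exact Finset.sum_nonneg fun i _ => mul_nonneg (hlam i).le (by positivity)
          · filter_upwards [hΓball] with p hp
            have h4 : (fun i => (P (p.2 i) : En n)) = p.2 :=
              funext fun i => ballProj_eq_self hR (hp i)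
            change wvar lam (fun i => (P (p.2 i) : En n)) ≤ _
            rw [h4]
            simpa only [norm_sub_rev] using wvar_le hL.ne' hL.le p.2 p.1
      _ = ∑ i, lam i * ∫ p, ‖p.1 - p.2‖ ^ 2 ∂(α i) := by
          rw [integral_finsetSum _ fun i _ => (hii i).const_mul _]
          simp only [integral_const_mul, hcost]
      _ ≤ ∑ i, lam i * (W2sq ρ (μ i) + e / ∑ i, lam i) :=
          Finset.sum_le_sum fun i _ => mul_le_mul_of_nonneg_left (hαlt i).le (hlam i).le
      _ = ∑ i, lam i * W2sq ρ (μ i) + e := by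
          simp only [mul_add, Finset.sum_add_distrib]
          rw [← Finset.sum_mul, mul_div_cancel₀ _ hL.ne']

theorem W2sq_self_le {n : ℕ} {μ : Measure (En n)} : W2sq μ μ ≤ 0 := by
  have := W2sq_map_le μ (measurable_id (α := En n)) measurable_id
  simpa using this

/-- A finite family of measures on a ball has an approximate barycenter whose density is bounded,
and which is close to a given measure as soon as the latter is nearly optimal. -/
theorem exists_penalized_measure {n : ℕ} (hn : n ≠ 0) {ι : Type*} [Fintype ι] {R : ℝ} (hR : 0 < R)
    {lam : ι → ℝ} (hlam : ∀ i, 0 < lam i) (μ : ι → Measure (En n))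
    [∀ i, IsProbabilityMeasure (μ i)] (hμ : ∀ i, μ i (Metric.closedBall 0 R)ᶜ = 0)
    (ρ : Measure (En n)) [IsProbabilityMeasure ρ] (hρ : ρ (Metric.closedBall 0 R)ᶜ = 0)
    (I : Finset ι) {K m e : ℝ} (hK : 0 ≤ K) (hm : 0 < m) (he : 0 < e) (hmI : m ≤ ∑ i ∈ I, lam i)
    (hI : ∀ i ∈ I, μ i ≤ ENNReal.ofReal K • volume) :
    ∃ ν : Measure (En n), IsProbabilityMeasure ν ∧ ν (Metric.closedBall 0 R)ᶜ = 0 ∧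
      ν ≤ ENNReal.ofReal (K * ((∑ i, lam i + e) / m) ^ n) • volume ∧
      ∑ i, lam i * W2sq (μ i) ν + e * W2sq ρ ν ≤ ∑ i, lam i * W2sq (μ i) ρ := by
  have : ∀ o : Option ι, IsProbabilityMeasure (o.elim ρ μ) := by
    rintro (_ | i)
    · assumption
    · exact inferInstanceAs (IsProbabilityMeasure (μ i))
  obtain ⟨ν, h1, h2, h3, h4⟩ := exists_wmean_measure hn hR
    (lam := fun o : Option ι => o.elim e lam) (by rintro (_ | i); exacts [he, hlam i])
    (fun o => o.elim ρ μ) (by rintro (_ | i); exacts [hρ, hμ i]) ρ hρ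
    (I.map Function.Embedding.some) hK hm (by simpa using hmI) (by simpa using hI)
  refine ⟨ν, h1, h2, ?_, ?_⟩
  · rw [Fintype.sum_option, add_comm] at h3
    exact h3
  · simp only [Fintype.sum_option, Option.elim_none, Option.elim_some] at h4
    have h5 := mul_le_mul_of_nonneg_left (W2sq_self_le (μ := ρ)) he.le
    simp only [W2sq_comm (μ := ρ) (ν := μ _)] at h4
    linarith

/-- A ball has finite continuous partitions of unity with small supports. -/
theorem exists_partition {n : ℕ} (R : ℝ) {δ : ℝ} (hδ : 0 < δ) :
    ∃ (F : Finset (En n)) (χ : En n → En n → ℝ), (∀ a, Continuous (χ a)) ∧ (∀ a x, 0 ≤ χ a x) ∧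
      (∀ x, ∑ a ∈ F, χ a x ≤ 1) ∧ (∀ x ∈ Metric.closedBall (0 : En n) R, ∑ a ∈ F, χ a x = 1) ∧
      ∀ a x, χ a x ≠ 0 → ‖x - a‖ ≤ 2 * δ := by
  obtain ⟨t, -, htf, ht⟩ := (isCompact_closedBall (0 : En n) R).finite_cover_balls hδ
  set F := htf.toFinset
  have hd : ∀ x, 0 < max (∑ a ∈ F, max 0 (2 * δ - ‖x - a‖)) δ := fun x => lt_max_of_lt_right hδ
  refine ⟨F, fun a x => max 0 (2 * δ - ‖x - a‖) / max (∑ a ∈ F, max 0 (2 * δ - ‖x - a‖)) δ,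
    fun a => ?_, fun a x => ?_, fun x => ?_, fun x hx => ?_, fun a x h => ?_⟩
  · refine Continuous.div (by fun_prop) (by fun_prop) fun x => (hd x).ne'
  · exact div_nonneg (le_max_left _ _) (hd x).le
  · rw [← Finset.sum_div, div_le_one (hd x)]
    exact le_max_left _ _
  · obtain ⟨a, ha, hxa⟩ := mem_iUnion₂.1 (ht hx)
    have h1 : δ ≤ ∑ a ∈ F, max 0 (2 * δ - ‖x - a‖) := by
      refine le_trans ?_ (Finset.single_le_sum (f := fun a => max 0 (2 * δ - ‖x - a‖))
        (fun a _ => le_max_left _ _) (htf.mem_toFinset.2 ha))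
      rw [Metric.mem_ball, dist_eq_norm] at hxa
      exact le_max_of_le_right (by linarith)
    rw [← Finset.sum_div, max_eq_left h1, div_self (hδ.trans_le h1).ne']
  · by_contra! hlt
    refine h ?_
    simp only [max_eq_left (show 2 * δ - ‖x - a‖ ≤ 0 by linarith), zero_div]

/-- Two measures giving similar masses to the pieces of a partition of unity are close. -/
theorem W2sq_le_of_partition {n : ℕ} {R δ e : ℝ} {μ ν : Measure (En n)} [IsProbabilityMeasure μ]
    [IsProbabilityMeasure ν] (hμ : μ (Metric.closedBall 0 R)ᶜ = 0)
    (hν : ν (Metric.closedBall 0 R)ᶜ = 0) (he0 : 0 ≤ e) (he1 : e < 1)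
    {F : Finset (En n)} {χ : En n → En n → ℝ} (hχc : ∀ a, Continuous (χ a))
    (hχ0 : ∀ a x, 0 ≤ χ a x) (hχ1 : ∀ x, ∑ a ∈ F, χ a x ≤ 1)
    (hχB : ∀ x ∈ Metric.closedBall (0 : En n) R, ∑ a ∈ F, χ a x = 1)
    (hχs : ∀ a x, χ a x ≠ 0 → ‖x - a‖ ≤ 2 * δ)
    (hw : ∀ a ∈ F, (1 - e) * ∫ x, χ a x ∂μ ≤ ∫ x, χ a x ∂ν) :
    W2sq μ ν ≤ (4 * δ) ^ 2 + e * (2 * R) ^ 2 := by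
  have hc : 0 < 1 - e := by linarith
  have hle1 : ∀ a ∈ F, ∀ x, χ a x ≤ 1 := fun a ha x =>
    (Finset.single_le_sum (f := fun a => χ a x) (fun a _ => hχ0 a x) ha).trans (hχ1 x)
  have hint : ∀ (m : Measure (En n)) [IsFiniteMeasure m], ∀ a ∈ F, Integrable (χ a) m :=
    fun m _ a ha => Integrable.of_bound (hχc a).aestronglyMeasurable 1
      (Filter.Eventually.of_forall fun x => by
        rw [Real.norm_of_nonneg (hχ0 a x)]
        exact hle1 a ha x)
  have hballμ : ∀ᵐ x ∂μ, x ∈ Metric.closedBall (0 : En n) R := by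
    filter_upwards [measure_eq_zero_iff_ae_notMem.1 hμ] with x hx
    simpa using hx
  have hballν : ∀ᵐ x ∂ν, x ∈ Metric.closedBall (0 : En n) R := by
    filter_upwards [measure_eq_zero_iff_ae_notMem.1 hν] with x hx
    simpa using hx
  set u : En n → ℝ := fun a => ∫ x, χ a x ∂μ with hu
  set v : En n → ℝ := fun a => ∫ x, χ a x ∂ν with hv
  have hu0 : ∀ a, 0 ≤ u a := fun a => integral_nonneg (hχ0 a)
  have hv0 : ∀ a, 0 ≤ v a := fun a => integral_nonneg (hχ0 a)
  have husum : ∑ a ∈ F, u a = 1 := by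
    rw [← integral_finsetSum _ (hint μ), integral_congr_ae (hballμ.mono hχB)]
    simp
  set k : En n → ℝ := fun a => (1 - e) / v a with hk
  have hk0 : ∀ a, 0 ≤ k a := fun a => div_nonneg hc.le (hv0 a)
  have hku : ∀ a ∈ F, k a * u a ≤ 1 := fun a ha => by
    rw [hk, div_mul_eq_mul_div]
    exact div_le_one_of_le₀ (hw a ha) (hv0 a)
  have hvu : ∀ a ∈ F, v a = 0 → u a = 0 := fun a ha h => by
    have := hw a ha
    have h2 := hu0 a
    change (1 - e) * u a ≤ v a at this
    rw [h] at this
    nlinarith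
  have hkvu : ∀ a ∈ F, k a * v a * u a = (1 - e) * u a := fun a ha => by
    rcases eq_or_ne (v a) 0 with h | h
    · rw [hvu a ha h]; simp
    · rw [hk, div_mul_cancel₀ _ h]
  have hkvuS : ∑ a ∈ F, k a * v a * u a = 1 - e := by
    rw [Finset.sum_congr rfl hkvu, ← Finset.mul_sum, husum, mul_one]
  let s : En n × En n → ℝ := fun p => ∑ a ∈ F, k a * (χ a p.1 * χ a p.2)
  let r : En n → ℝ := fun y => 1 - ∑ a ∈ F, k a * u a * χ a y
  have hs0 : ∀ p, 0 ≤ s p := fun p =>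
    Finset.sum_nonneg fun a _ => mul_nonneg (hk0 a) (mul_nonneg (hχ0 _ _) (hχ0 _ _))
  have hr0 : ∀ y, 0 ≤ r y := fun y => sub_nonneg.2 <|
    (Finset.sum_le_sum fun a ha => mul_le_of_le_one_left (hχ0 a y) (hku a ha)).trans (hχ1 y)
  have hsc : Continuous s := by fun_prop
  have hrc : Continuous r := by fun_prop
  have hsi1 : ∀ a ∈ F, ∀ x, Integrable (fun y => k a * (χ a x * χ a y)) ν := fun a ha x =>
    ((hint ν a ha).const_mul _).const_mul _
  have hsi2 : ∀ a ∈ F, ∀ y, Integrable (fun x => k a * (χ a x * χ a y)) μ := fun a ha y =>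
    ((hint μ a ha).mul_const _).const_mul _
  have hsi : ∀ a ∈ F, Integrable (fun p : En n × En n => k a * (χ a p.1 * χ a p.2)) (μ.prod ν) :=
    fun a ha => ((hint μ a ha).mul_prod (hint ν a ha)).const_mul _
  have hri : Integrable r ν :=
    (integrable_const _).sub (integrable_finsetSum _ fun a ha => (hint ν a ha).const_mul _)
  have hr : ∫ y, r y ∂ν = e := by
    rw [integral_sub (integrable_const _)
      (integrable_finsetSum _ fun a ha => (hint ν a ha).const_mul _),
      integral_finsetSum _ fun a ha => (hint ν a ha).const_mul _]
    simp only [integral_const_mul]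
    change _ - ∑ a ∈ F, k a * u a * v a = e
    simp only [mul_right_comm (k _) (u _), hkvuS]
    simp
  have hsν : ∀ x, ∫ y, s (x, y) ∂ν = ∑ a ∈ F, k a * v a * χ a x := fun x => by
    rw [integral_finsetSum _ fun a ha => hsi1 a ha x]
    refine Finset.sum_congr rfl fun a _ => ?_
    simp only [integral_const_mul]
    change k a * (χ a x * v a) = _
    ring
  have hsμ : ∀ y, ∫ x, s (x, y) ∂μ = ∑ a ∈ F, k a * u a * χ a y := fun y => by
    rw [integral_finsetSum _ fun a ha => hsi2 a ha y]
    refine Finset.sum_congr rfl fun a _ => ?_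
    simp only [integral_const_mul, integral_mul_const]
    change k a * (u a * χ a y) = _
    ring
  have hspr : ∫ p, s p ∂(μ.prod ν) = 1 - e := by
    rw [integral_finsetSum _ hsi, ← hkvuS]
    refine Finset.sum_congr rfl fun a _ => ?_
    rw [integral_const_mul, integral_prod_mul (χ a) (χ a)]
    change k a * (u a * v a) = _
    ring
  let h : En n × En n → ℝ := fun p => s p + r p.2
  have hh0 : ∀ p, 0 ≤ h p := fun p => add_nonneg (hs0 p) (hr0 _)
  have hhm : Measurable h := (hsc.add (hrc.comp continuous_snd)).measurable
  have hhm' : Measurable fun p => ENNReal.ofReal (h p) := hhm.ennreal_ofReal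
  have hone1 : ∀ᵐ x ∂μ, ∫⁻ y, ENNReal.ofReal (h (x, y)) ∂ν = 1 := by
    have h1 : ∀ᵐ x ∂μ, ∀ a ∈ F, u a = 0 → χ a x = 0 := by
      refine (Filter.eventually_all_finset F).2 fun a ha => ?_
      by_cases hua : u a = 0
      · filter_upwards [(integral_eq_zero_iff_of_nonneg (hχ0 a) (hint μ a ha)).1 hua] with x hx _
        exact hx
      · exact Filter.Eventually.of_forall fun x h => absurd h hua
    filter_upwards [h1, hballμ] with x hx hxB
    have hi : Integrable (fun y => h (x, y)) ν :=
      (integrable_finsetSum _ fun a ha => hsi1 a ha x).add hri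
    rw [← ofReal_integral_eq_lintegral_ofReal hi (Filter.Eventually.of_forall fun y => hh0 _)]
    have h2 : ∫ y, h (x, y) ∂ν = (∑ a ∈ F, k a * v a * χ a x) + e := by
      rw [← hsν, ← hr, ← integral_add (integrable_finsetSum _ fun a ha => hsi1 a ha x) hri]
    have h3 : ∑ a ∈ F, k a * v a * χ a x = 1 - e := by
      calc ∑ a ∈ F, k a * v a * χ a x = ∑ a ∈ F, (1 - e) * χ a x := ?_
        _ = 1 - e := by rw [← Finset.mul_sum, hχB x hxB, mul_one]
      refine Finset.sum_congr rfl fun a ha => ?_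
      rcases eq_or_ne (v a) 0 with h | h
      · rw [hx a ha (hvu a ha h)]; simp
      · rw [hk, div_mul_cancel₀ _ h]
    rw [h2, h3]
    simp
  have hone2 : ∀ y, ∫⁻ x, ENNReal.ofReal (h (x, y)) ∂μ = 1 := fun y => by
    have hi : Integrable (fun x => h (x, y)) μ :=
      (integrable_finsetSum _ fun a ha => hsi2 a ha y).add (integrable_const (r y))
    rw [← ofReal_integral_eq_lintegral_ofReal hi (Filter.Eventually.of_forall fun y => hh0 _)]
    have h2 : ∫ x, h (x, y) ∂μ = (∑ a ∈ F, k a * u a * χ a y) + r y := by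
      have : r y = ∫ _x, r y ∂μ := by simp
      rw [← hsμ, this,
        ← integral_add (integrable_finsetSum _ fun a ha => hsi2 a ha y) (integrable_const _)]
    rw [h2]
    simp [r]
  let γ := (μ.prod ν).withDensity fun p => ENNReal.ofReal (h p)
  have hγ : IsCoupling γ μ ν := by
    constructor
    · ext A hA
      rw [Measure.map_apply measurable_fst hA, withDensity_apply _ (measurable_fst hA),
        ← prod_univ, ← Measure.prod_restrict, Measure.restrict_univ,
        lintegral_prod _ hhm'.aemeasurable, lintegral_congr_ae (ae_restrict_of_ae hone1)]
      simp
    · ext A hA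
      rw [Measure.map_apply measurable_snd hA, withDensity_apply _ (measurable_snd hA),
        ← univ_prod, ← Measure.prod_restrict, Measure.restrict_univ,
        lintegral_prod_symm _ hhm'.aemeasurable]
      simp [hone2]
  refine (W2sq_le hγ).trans ?_
  have hri2 : Integrable (fun p : En n × En n => r p.2) (μ.prod ν) := hri.comp_snd μ
  have hri3 : ∫ p, r p.2 ∂(μ.prod ν) = e := by
    rw [← hr, integral_fun_snd]
    simp
  rw [integral_withDensity_eq_integral_toReal_smul hhm'
    (Filter.Eventually.of_forall fun _ => ENNReal.ofReal_lt_top)]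
  have hb : ∫ p, (ENNReal.ofReal (h p)).toReal • ‖p.1 - p.2‖ ^ 2 ∂(μ.prod ν) ≤
      ∫ p, ((4 * δ) ^ 2 * s p + (2 * R) ^ 2 * r p.2) ∂(μ.prod ν) := by
    refine integral_mono_of_nonneg (Filter.Eventually.of_forall fun p => by positivity)
      (((integrable_finsetSum _ hsi).const_mul _).add (hri2.const_mul _)) ?_
    filter_upwards [(Measure.quasiMeasurePreserving_fst (μ := μ) (ν := ν)).ae hballμ,
      (Measure.quasiMeasurePreserving_snd (μ := μ) (ν := ν)).ae hballν] with p hp1 hp2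
    rw [mem_closedBall_zero_iff] at hp1 hp2
    simp only [ENNReal.toReal_ofReal (hh0 p), smul_eq_mul, h, add_mul]
    have h1 : r p.2 * ‖p.1 - p.2‖ ^ 2 ≤ (2 * R) ^ 2 * r p.2 := by
      rw [mul_comm]
      refine mul_le_mul_of_nonneg_right (pow_le_pow_left₀ (norm_nonneg _) ?_ 2) (hr0 _)
      exact (norm_sub_le _ _).trans (by linarith)
    have h2 : s p * ‖p.1 - p.2‖ ^ 2 ≤ (4 * δ) ^ 2 * s p := by
      simp only [s, Finset.sum_mul, Finset.mul_sum]
      refine Finset.sum_le_sum fun a _ => ?_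
      by_cases hz : χ a p.1 * χ a p.2 = 0
      · simp [hz]
      · rw [mul_comm]
        refine mul_le_mul_of_nonneg_right (pow_le_pow_left₀ (norm_nonneg _) ?_ 2)
          (mul_nonneg (hk0 a) (mul_nonneg (hχ0 _ _) (hχ0 _ _)))
        have h3 := hχs a _ (left_ne_zero_of_mul hz)
        have h4 := hχs a _ (right_ne_zero_of_mul hz)
        have h5 := norm_sub_le (p.1 - a) (p.2 - a)
        rw [sub_sub_sub_cancel_right] at h5
        linarith
    exact add_le_add h2 h1
  rw [integral_add ((integrable_finsetSum _ hsi).const_mul _) (hri2.const_mul _),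
    integral_const_mul, integral_const_mul, hri3, hspr] at hb
  nlinarith [sq_nonneg (4 * δ)]

/-- Weak convergence of measures on a ball implies convergence for the Wasserstein distance. -/
theorem tendsto_W2sq_of_tendsto_integral {n : ℕ} {R : ℝ} {α : Type*} {l : Filter α}
    {μ : α → Measure (En n)} {ν : Measure (En n)} [IsProbabilityMeasure ν]
    (hp : ∀ᶠ i in l, IsProbabilityMeasure (μ i))
    (hμ : ∀ᶠ i in l, μ i (Metric.closedBall 0 R)ᶜ = 0) (hν : ν (Metric.closedBall 0 R)ᶜ = 0)
    (h : ∀ f : BoundedContinuousFunction (En n) ℝ,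
      Filter.Tendsto (fun i => ∫ x, f x ∂(μ i)) l (nhds (∫ x, f x ∂ν))) :
    Filter.Tendsto (fun i => W2sq ν (μ i)) l (nhds 0) := by
  have key : ∀ c > 0, ∀ᶠ i in l, W2sq ν (μ i) ≤ c := by
    intro c hc
    obtain ⟨δ, hδ, hδc⟩ : ∃ δ > 0, (4 * δ) ^ 2 < c / 2 := by
      have h1 : Filter.Tendsto (fun δ : ℝ => (4 * δ) ^ 2) (nhdsWithin 0 (Ioi 0)) (nhds 0) := by
        have : Continuous fun δ : ℝ => (4 * δ) ^ 2 := by fun_prop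
        simpa using (this.tendsto 0).mono_left nhdsWithin_le_nhds
      obtain ⟨δ, h2, h3⟩ := ((h1.eventually (gt_mem_nhds (half_pos hc))).and
        self_mem_nhdsWithin).exists
      exact ⟨δ, h3, h2⟩
    obtain ⟨e, he, he1, hec⟩ : ∃ e > 0, e < 1 ∧ e * (2 * R) ^ 2 < c / 2 := by
      have h1 : Filter.Tendsto (fun e : ℝ => e * (2 * R) ^ 2) (nhdsWithin 0 (Ioi 0)) (nhds 0) := by
        have : Continuous fun e : ℝ => e * (2 * R) ^ 2 := by fun_prop
        simpa using (this.tendsto 0).mono_left nhdsWithin_le_nhds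
      have h4 : ∀ᶠ e : ℝ in nhdsWithin 0 (Ioi 0), e < 1 :=
        nhdsWithin_le_nhds (gt_mem_nhds one_pos)
      obtain ⟨e, h2, h3, h5⟩ := ((h1.eventually (gt_mem_nhds (half_pos hc))).and
        (h4.and self_mem_nhdsWithin)).exists
      exact ⟨e, h5, h3, h2⟩
    obtain ⟨F, χ, hχc, hχ0, hχ1, hχB, hχs⟩ := exists_partition (n := n) R hδ
    have hw : ∀ᶠ i in l, ∀ a ∈ F, (1 - e) * ∫ x, χ a x ∂ν ≤ ∫ x, χ a x ∂(μ i) := by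
      refine (Filter.eventually_all_finset F).2 fun a ha => ?_
      rcases (integral_nonneg (μ := ν) (f := χ a) fun x => hχ0 a x).eq_or_lt with h0 | h0
      · refine Filter.Eventually.of_forall fun i => ?_
        rw [← h0, mul_zero]
        exact integral_nonneg fun x => hχ0 a x
      · have hb : ∀ x, ‖χ a x‖ ≤ 1 := fun x => by
          rw [Real.norm_of_nonneg (hχ0 a x)]
          exact (Finset.single_le_sum (f := fun a => χ a x) (fun a _ => hχ0 a x) ha).trans (hχ1 x)
        have h2 := h (BoundedContinuousFunction.ofNormedAddCommGroup (χ a) (hχc a) 1 hb)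
        have h3 : (1 - e) * ∫ x, χ a x ∂ν < ∫ x, χ a x ∂ν := by nlinarith
        exact (h2.eventually (lt_mem_nhds h3)).mono fun i hi => hi.le
    filter_upwards [hp, hμ, hw] with i hpi hμi hwi
    have := W2sq_le_of_partition hν hμi he.le he1 hχc hχ0 hχ1 hχB hχs hwi
    linarith
  refine tendsto_order.2 ⟨fun a ha => ?_, fun a ha => ?_⟩
  · exact Filter.Eventually.of_forall fun i => ha.trans_le W2sq_nonneg
  · exact (key (a / 2) (half_pos ha)).mono fun i hi => hi.trans_lt (half_lt_self ha)

theorem W2sq_map_ballProj_add_le {n : ℕ} {R : ℝ} (hR : 0 < R) {μ ν : Measure (En n)}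
    [IsProbabilityMeasure μ] [IsProbabilityMeasure ν] (hμ : μ (Metric.closedBall 0 R)ᶜ = 0)
    (hν : FinSecMom ν) :
    W2sq μ (ν.map (ballProj R)) + ∫ y, ‖y - ballProj R y‖ ^ 2 ∂ν ≤ W2sq μ ν := by
  refine le_of_forall_pos_le_add fun e he => ?_
  obtain ⟨γ, hγ, hlt⟩ := exists_coupling_lt (μ := μ) (ν := ν) he
  refine le_trans ?_ hlt.le
  have hP : Measurable (ballProj R : En n → En n) := (continuous_ballProj hR).measurable
  have hPs : FinSecMom (ν.map (ballProj R)) := by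
    have := Measure.isProbabilityMeasure_map (μ := ν) hP.aemeasurable
    refine FinSecMom.of_compl_closedBall (R := R) ?_
    rw [Measure.map_apply hP Metric.isClosed_closedBall.measurableSet.compl]
    convert measure_empty (μ := ν)
    exact eq_empty_of_forall_notMem fun x hx => hx (ballProj_mem hR x)
  have hμs : FinSecMom μ := FinSecMom.of_compl_closedBall hμ
  have hmap : γ.map (fun p => ballProj R p.2) = ν.map (ballProj R) := by
    rw [← hγ.2, Measure.map_map hP measurable_snd]
    rfl
  have hm1 : Measurable (fun p : En n × En n => p.1) := measurable_fst
  have hm2 : Measurable (fun p : En n × En n => p.2) := measurable_snd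
  have hm3 : Measurable (fun p : En n × En n => ballProj R p.2) := hP.comp measurable_snd
  have f1 : FinSecMom (γ.map fun p => p.1) := by rw [hγ.1]; exact hμs
  have f2 : FinSecMom (γ.map fun p => p.2) := by rw [hγ.2]; exact hν
  have f3 : FinSecMom (γ.map fun p => ballProj R p.2) := by rw [hmap]; exact hPs
  have h1 := W2sq_map_le γ hm1 hm3
  rw [hmap, hγ.1] at h1
  have h2 : ∫ y, ‖y - ballProj R y‖ ^ 2 ∂ν = ∫ p, ‖p.2 - ballProj R p.2‖ ^ 2 ∂γ := by
    rw [← hγ.2, integral_map measurable_snd.aemeasurable]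
    exact ((measurable_id.sub hP).norm.pow_const 2).aestronglyMeasurable
  rw [h2]
  refine (add_le_add_left h1 _).trans ?_
  rw [← integral_add (integrable_norm_sub_sq hm1 hm3 f1 f3) (integrable_norm_sub_sq hm2 hm3 f2 f3)]
  refine integral_mono_ae ((integrable_norm_sub_sq hm1 hm3 f1 f3).add
    (integrable_norm_sub_sq hm2 hm3 f2 f3)) (integrable_norm_sub_sq hm1 hm2 f1 f2) ?_
  have h3 : ∀ᵐ p ∂γ, ‖p.1‖ ≤ R := by
    have : ∀ᵐ x ∂(γ.map Prod.fst), ‖x‖ ≤ R := by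
      rw [hγ.1]
      filter_upwards [measure_eq_zero_iff_ae_notMem.1 hμ] with x hx
      simpa using hx
    exact ae_of_ae_map measurable_fst.aemeasurable this
  filter_upwards [h3] with p hp
  exact norm_sub_ballProj_add_le hR hp p.2

theorem WeakContOn.tendsto_W2sq {n : ℕ} {R : ℝ} {μ : ℝ → Measure (En n)} {S : Set ℝ}
    (hcont : WeakContOn μ S) (hp : ∀ t ∈ S, IsProbabilityMeasure (μ t))
    (hμ : ∀ t ∈ S, μ t (Metric.closedBall 0 R)ᶜ = 0) {t : ℝ} (ht : t ∈ S) :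
    Filter.Tendsto (fun s => W2sq (μ t) (μ s)) (nhdsWithin t S) (nhds 0) := by
  have := hp t ht
  exact tendsto_W2sq_of_tendsto_integral (eventually_mem_nhdsWithin.mono hp)
    (eventually_mem_nhdsWithin.mono hμ) (hμ t ht) fun f => hcont f t ht

theorem WeakContOn.continuousOn_W2sq {n : ℕ} {R : ℝ} {μ : ℝ → Measure (En n)} {S : Set ℝ}
    (hcont : WeakContOn μ S) (hp : ∀ t ∈ S, IsProbabilityMeasure (μ t))
    (hμ : ∀ t ∈ S, μ t (Metric.closedBall 0 R)ᶜ = 0) {ν : Measure (En n)}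
    [IsProbabilityMeasure ν] (hν : FinSecMom ν) :
    ContinuousOn (fun t => W2sq (μ t) ν) S := by
  have h : ContinuousOn (fun t => √(W2sq (μ t) ν)) S := fun t ht => by
    refine tendsto_iff_norm_sub_tendsto_zero.2 ?_
    have h1 : Filter.Tendsto (fun s => √(W2sq (μ t) (μ s))) (nhdsWithin t S) (nhds 0) := by
      simpa using (hcont.tendsto_W2sq hp hμ ht).sqrt
    refine squeeze_zero' (Filter.Eventually.of_forall fun _ => norm_nonneg _) ?_ h1
    filter_upwards [self_mem_nhdsWithin] with s hs
    have := hp s hs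
    have := hp t ht
    rw [W2sq_comm (μ := μ t) (ν := μ s)]
    exact abs_sqrt_W2sq_sub_le (FinSecMom.of_compl_closedBall (hμ s hs))
      (FinSecMom.of_compl_closedBall (hμ t ht)) hν
  refine (h.pow 2).congr fun t _ => ?_
  exact (Real.sq_sqrt W2sq_nonneg).symm

/-- The barycenter of a curve of measures on a ball lives on that ball. -/
theorem IsBarycenter.compl_closedBall {n : ℕ} {R : ℝ} (hR : 0 < R) {μ : ℝ → Measure (En n)}
    (hcont : WeakContOn μ (Icc 0 1)) (hp : ∀ t ∈ Icc (0 : ℝ) 1, IsProbabilityMeasure (μ t))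
    (hμ : ∀ t ∈ Icc (0 : ℝ) 1, μ t (Metric.closedBall 0 R)ᶜ = 0) {μb : Measure (En n)}
    (h : IsBarycenter μ μb) : μb (Metric.closedBall 0 R)ᶜ = 0 := by
  obtain ⟨hb, hbs, hmin⟩ := h
  have hP : Measurable (ballProj R : En n → En n) := (continuous_ballProj hR).measurable
  have hPp := Measure.isProbabilityMeasure_map (μ := μb) hP.aemeasurable
  have hPs : FinSecMom (μb.map (ballProj R)) := by
    refine FinSecMom.of_compl_closedBall (R := R) ?_
    rw [Measure.map_apply hP Metric.isClosed_closedBall.measurableSet.compl]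
    convert measure_empty (μ := μb)
    exact eq_empty_of_forall_notMem fun x hx => hx (ballProj_mem hR x)
  set c := ∫ y, ‖y - ballProj R y‖ ^ 2 ∂μb with hc
  have i1 : IntegrableOn (fun t => W2sq (μ t) μb) (Icc 0 1) :=
    (hcont.continuousOn_W2sq hp hμ hbs).integrableOn_compact isCompact_Icc
  have i2 : IntegrableOn (fun t => W2sq (μ t) (μb.map (ballProj R))) (Icc 0 1) :=
    (hcont.continuousOn_W2sq hp hμ hPs).integrableOn_compact isCompact_Icc
  have h1 : ∫ t in Icc (0 : ℝ) 1, (W2sq (μ t) (μb.map (ballProj R)) + c) ≤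
      ∫ t in Icc (0 : ℝ) 1, W2sq (μ t) μb := by
    refine setIntegral_mono_on (i2.add (by simp)) i1 measurableSet_Icc fun t ht => ?_
    have := hp t ht
    exact W2sq_map_ballProj_add_le hR (hμ t ht) hbs
  rw [integral_add i2 (by simp)] at h1
  have h2 : c ≤ 0 := by
    have := hmin _ hPp hPs
    simp at h1
    linarith
  have hi : Integrable (fun y => ‖y - ballProj R y‖ ^ 2) μb :=
    integrable_norm_sub_sq measurable_id hP (by rwa [Measure.map_id']) hPs
  have h3 := (integral_eq_zero_iff_of_nonneg (fun y => by positivity) hi).1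
    (h2.antisymm (integral_nonneg fun y => by positivity))
  rw [measure_eq_zero_iff_ae_notMem]
  filter_upwards [h3] with y hy
  have hy : ‖y - ballProj R y‖ ^ 2 = 0 := hy
  have : y = ballProj R y := by simpa [sub_eq_zero] using hy
  rw [this]
  exact not_not_intro (ballProj_mem hR y)

theorem measure_le_thickening_add {n : ℕ} {ρ ν : Measure (En n)} [IsProbabilityMeasure ρ]
    [IsProbabilityMeasure ν] (hρ : FinSecMom ρ) (hν : FinSecMom ν) {δ e : ℝ} (hδ : 0 < δ)
    (he : W2sq ρ ν < e) {F : Set (En n)} (hF : MeasurableSet F) :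
    ρ F ≤ ν (Metric.cthickening δ F) + ENNReal.ofReal (e / δ ^ 2) := by
  obtain ⟨γ, hγ, hlt⟩ := exists_coupling_lt (μ := ρ) (ν := ν) (sub_pos.2 he)
  have := hγ.isProbabilityMeasure
  have hm1 : Measurable (fun p : En n × En n => p.1) := measurable_fst
  have hm2 : Measurable (fun p : En n × En n => p.2) := measurable_snd
  have hi : Integrable (fun p : En n × En n => ‖p.1 - p.2‖ ^ 2) γ :=
    integrable_norm_sub_sq hm1 hm2 (by rw [hγ.1]; exact hρ) (by rw [hγ.2]; exact hν)
  have h1 := mul_meas_ge_le_integral_of_nonneg (μ := γ)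
    (Filter.Eventually.of_forall fun p => by positivity) hi (δ ^ 2)
  have h2 : γ {p | δ ^ 2 ≤ ‖p.1 - p.2‖ ^ 2} ≤ ENNReal.ofReal (e / δ ^ 2) := by
    rw [← ofReal_measureReal]
    refine ENNReal.ofReal_le_ofReal ?_
    rw [le_div_iff₀ (by positivity), mul_comm]
    linarith
  have hF' : ρ F = γ (Prod.fst ⁻¹' F) := by rw [← hγ.1, Measure.map_apply measurable_fst hF]
  have hT : ν (Metric.cthickening δ F) = γ (Prod.snd ⁻¹' Metric.cthickening δ F) := by
    rw [← hγ.2, Measure.map_apply measurable_snd Metric.isClosed_cthickening.measurableSet]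
  rw [hF', hT]
  refine (measure_mono ?_).trans ((measure_union_le _ _).trans (add_le_add_right h2 _))
  intro p hp
  by_cases h : δ ^ 2 ≤ ‖p.1 - p.2‖ ^ 2
  · exact Or.inr h
  · left
    have h3 : ‖p.1 - p.2‖ < δ := lt_of_pow_lt_pow_left₀ 2 hδ.le (not_le.1 h)
    refine Metric.mem_cthickening_of_dist_le p.2 p.1 δ F hp ?_
    rw [dist_comm, dist_eq_norm]
    exact h3.le

/-- Upper bounds on the density pass to the limit for the Wasserstein distance. -/
theorem le_smul_volume_of_W2sq_lt {n : ℕ} {ρ : Measure (En n)} [IsProbabilityMeasure ρ]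
    (hρ : FinSecMom ρ) {C : ℝ}
    (h : ∀ e > 0, ∃ ν : Measure (En n), IsProbabilityMeasure ν ∧ FinSecMom ν ∧
      ν ≤ ENNReal.ofReal (C + e) • volume ∧ W2sq ρ ν < e) :
    ρ ≤ ENNReal.ofReal C • volume := by
  have hthick : ∀ F : Set (En n), IsCompact F → ∀ δ > 0,
      ρ F ≤ ENNReal.ofReal C * volume (Metric.cthickening δ F) := by
    intro F hF δ hδ
    have h1 : Filter.Tendsto (fun e : ℝ => ENNReal.ofReal (C + e) *
        volume (Metric.cthickening δ F) + ENNReal.ofReal (e / δ ^ 2)) (nhdsWithin 0 (Ioi 0))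
        (nhds (ENNReal.ofReal C * volume (Metric.cthickening δ F))) := by
      have h2 : Filter.Tendsto (fun e : ℝ => ENNReal.ofReal (C + e)) (nhds 0)
          (nhds (ENNReal.ofReal C)) := by
        have : Continuous fun e : ℝ => ENNReal.ofReal (C + e) :=
          ENNReal.continuous_ofReal.comp (by fun_prop)
        simpa using this.tendsto 0
      have h3 : Filter.Tendsto (fun e : ℝ => ENNReal.ofReal (e / δ ^ 2)) (nhds 0) (nhds 0) := by
        have : Continuous fun e : ℝ => ENNReal.ofReal (e / δ ^ 2) :=
          ENNReal.continuous_ofReal.comp (by fun_prop)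
        simpa using this.tendsto 0
      have hfin : volume (Metric.cthickening δ F) ≠ ⊤ := hF.cthickening.measure_lt_top.ne
      have h4 := (ENNReal.Tendsto.mul_const h2 (Or.inr hfin)).add h3
      rw [add_zero] at h4
      exact h4.mono_left nhdsWithin_le_nhds
    refine ge_of_tendsto h1 ?_
    filter_upwards [self_mem_nhdsWithin] with e he
    obtain ⟨ν, hp, hs, hle, hlt⟩ := h e he
    refine (measure_le_thickening_add hρ hs hδ hlt hF.measurableSet).trans ?_
    gcongr
    exact hle _
  have hcomp : ∀ F : Set (En n), IsCompact F → ρ F ≤ ENNReal.ofReal C * volume F := by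
    intro F hF
    have h1 : Filter.Tendsto (fun δ => ENNReal.ofReal C * volume (Metric.cthickening δ F))
        (nhdsWithin 0 (Ioi 0)) (nhds (ENNReal.ofReal C * volume F)) :=
      ENNReal.Tendsto.const_mul ((tendsto_measure_cthickening_of_isCompact hF).mono_left
        nhdsWithin_le_nhds) (Or.inr ENNReal.ofReal_ne_top)
    refine ge_of_tendsto h1 ?_
    filter_upwards [self_mem_nhdsWithin] with δ hδ
    exact hthick F hF δ hδ
  refine Measure.le_iff.2 fun A hA => ?_
  rw [hA.measure_eq_iSup_isCompact]
  refine iSup₂_le fun F hFA => iSup_le fun hF => (hcomp F hF).trans ?_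
  exact mul_le_mul_right (measure_mono hFA) _

theorem withDensity_le_smul_volume {n : ℕ} {g : En n → ℝ} {K : ℝ}
    (hg : eLpNorm g ⊤ volume ≤ ENNReal.ofReal K) :
    (volume : Measure (En n)).withDensity (fun x => ENNReal.ofReal (g x)) ≤
      ENNReal.ofReal K • volume := by
  rw [← withDensity_const]
  refine withDensity_mono ?_
  rw [eLpNorm_exponent_top] at hg
  filter_upwards [ae_le_eLpNormEssSup (f := g) (μ := (volume : Measure (En n)))] with x hx
  refine le_trans ?_ (hx.trans hg)
  rw [← ofReal_norm]
  exact ENNReal.ofReal_le_ofReal (le_abs_self _)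

theorem exists_density_of_le_smul_volume {n : ℕ} {ρ : Measure (En n)} [IsFiniteMeasure ρ] {C : ℝ}
    (h : ρ ≤ ENNReal.ofReal C • volume) :
    ∃ g : En n → ℝ, ρ = volume.withDensity (fun x => ENNReal.ofReal (g x)) ∧
      eLpNorm g ⊤ volume ≤ ENNReal.ofReal C := by
  have hac : ρ ≪ volume :=
    (Measure.absolutelyContinuous_of_le h).trans Measure.smul_absolutelyContinuous
  refine ⟨fun x => (ρ.rnDeriv volume x).toReal, ?_, ?_⟩
  · rw [← Measure.withDensity_rnDeriv_eq ρ volume hac]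
    refine withDensity_congr_ae ?_
    rw [Measure.withDensity_rnDeriv_eq ρ volume hac]
    filter_upwards [Measure.rnDeriv_lt_top ρ volume] with x hx
    rw [ENNReal.ofReal_toReal hx.ne]
  · have hle : ρ.rnDeriv volume ≤ᵐ[volume] fun _ => ENNReal.ofReal C := by
      refine ae_le_of_forall_setLIntegral_le_of_sigmaFinite (Measure.measurable_rnDeriv _ _) ?_
      intro s hs _
      rw [setLIntegral_const]
      exact (Measure.setLIntegral_rnDeriv_le s).trans (h s)
    rw [eLpNorm_exponent_top]
    refine essSup_le_of_ae_le _ ?_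
    filter_upwards [hle, Measure.rnDeriv_lt_top ρ volume] with x hx hx2
    rw [← ofReal_norm, Real.norm_of_nonneg ENNReal.toReal_nonneg,
      ENNReal.ofReal_toReal hx2.ne]
    exact hx

theorem integral_comp_simpleFunc {α β : Type*} [MeasurableSpace α] (m : Measure α)
    [IsFiniteMeasure m] (τ : SimpleFunc α β) (ψ : β → ℝ) :
    ∫ t, ψ (τ t) ∂m = ∑ s ∈ τ.range, m.real (τ ⁻¹' {s}) * ψ s := by
  classical
  have h : ∀ t, ψ (τ t) = ∑ s ∈ τ.range, (τ ⁻¹' {s}).indicator (fun _ => ψ s) t := fun t => by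
    simp only [indicator_apply, mem_preimage, mem_singleton_iff]
    rw [Finset.sum_ite_eq, if_pos (τ.mem_range_self t)]
  simp only [h]
  rw [integral_finsetSum _ fun s _ =>
    (integrable_const (ψ s)).indicator (τ.measurableSet_fiber s)]
  refine Finset.sum_congr rfl fun s _ => ?_
  rw [integral_indicator_const _ (τ.measurableSet_fiber s), smul_eq_mul]

theorem aestronglyMeasurable_comp_simpleFunc {α β : Type*} [MeasurableSpace α] {m : Measure α}
    (τ : SimpleFunc α β) {F : α → β → ℝ} (hF : ∀ s ∈ τ.range,
      AEStronglyMeasurable (fun t => F t s) m) : AEStronglyMeasurable (fun t => F t (τ t)) m := by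
  classical
  have h : (fun t => F t (τ t)) = fun t => ∑ s ∈ τ.range, (τ ⁻¹' {s}).indicator (F · s) t := by
    ext t
    simp only [indicator_apply, mem_preimage, mem_singleton_iff]
    rw [Finset.sum_ite_eq, if_pos (τ.mem_range_self t)]
  rw [h]
  exact Finset.aestronglyMeasurable_fun_sum _ fun s hs =>
    (hF s hs).indicator (τ.measurableSet_fiber s)

theorem abs_W2sq_sub_le {n : ℕ} {R : ℝ} (hR : 0 < R) {μ ν ρ : Measure (En n)}
    [IsProbabilityMeasure μ] [IsProbabilityMeasure ν] [IsProbabilityMeasure ρ]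
    (hμ : μ (Metric.closedBall 0 R)ᶜ = 0) (hν : ν (Metric.closedBall 0 R)ᶜ = 0)
    (hρ : ρ (Metric.closedBall 0 R)ᶜ = 0) :
    |W2sq μ ρ - W2sq ν ρ| ≤ 4 * R * √(W2sq μ ν) := by
  have h1 := abs_sqrt_W2sq_sub_le (FinSecMom.of_compl_closedBall hμ)
    (FinSecMom.of_compl_closedBall hν) (FinSecMom.of_compl_closedBall hρ)
  have h2 : √(W2sq μ ρ) ≤ 2 * R := Real.sqrt_le_left (by positivity) |>.2
    (W2sq_le_of_compl_closedBall hμ hρ)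
  have h3 : √(W2sq ν ρ) ≤ 2 * R := Real.sqrt_le_left (by positivity) |>.2
    (W2sq_le_of_compl_closedBall hν hρ)
  have h4 : W2sq μ ρ - W2sq ν ρ =
      (√(W2sq μ ρ) + √(W2sq ν ρ)) * (√(W2sq μ ρ) - √(W2sq ν ρ)) := by
    rw [← sq_sub_sq, Real.sq_sqrt W2sq_nonneg, Real.sq_sqrt W2sq_nonneg]
  rw [h4, abs_mul, abs_of_nonneg (by positivity)]
  exact mul_le_mul (by linarith) h1 (abs_nonneg _) (by positivity)

/-- A curve of measures on a ball is well approximated by its values along a simple function that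
preserves a given set of times. -/
theorem WeakContOn.exists_simpleFunc {n : ℕ} {R : ℝ} (hR : 0 < R) {μ : ℝ → Measure (En n)}
    (hcont : WeakContOn μ (Icc 0 1)) (hp : ∀ t ∈ Icc (0 : ℝ) 1, IsProbabilityMeasure (μ t))
    (hμ : ∀ t ∈ Icc (0 : ℝ) 1, μ t (Metric.closedBall 0 R)ᶜ = 0) {A : Set ℝ}
    (hA : MeasurableSet A) (hA0 : A.Nonempty) (hA1 : A ⊆ Icc 0 1) {e : ℝ} (he : 0 < e) :
    ∃ τ : SimpleFunc ℝ ℝ, (∀ t, τ t ∈ Icc (0 : ℝ) 1) ∧ (∀ t ∈ A, τ t ∈ A) ∧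
      IntegrableOn (fun t => √(W2sq (μ t) (μ (τ t)))) (Icc 0 1) ∧
      ∫ t in Icc (0 : ℝ) 1, √(W2sq (μ t) (μ (τ t))) < e := by
  classical
  obtain ⟨a, ha⟩ := hA0
  let τ : ℕ → SimpleFunc ℝ ℝ := fun k => SimpleFunc.piecewise A hA
    (SimpleFunc.approxOn id measurable_id A a ha k)
    (SimpleFunc.approxOn id measurable_id (Icc 0 1) a (hA1 ha) k)
  have hτ1 : ∀ k, ∀ t ∈ A, τ k t ∈ A := fun k t ht => by
    simp only [τ, SimpleFunc.piecewise_apply, if_pos ht]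
    exact SimpleFunc.approxOn_mem measurable_id ha k t
  have hτ0 : ∀ k t, τ k t ∈ Icc (0 : ℝ) 1 := fun k t => by
    by_cases ht : t ∈ A
    · exact hA1 (hτ1 k t ht)
    · simp only [τ, SimpleFunc.piecewise_apply, if_neg ht]
      exact SimpleFunc.approxOn_mem measurable_id (hA1 ha) k t
  have hτl : ∀ t ∈ Icc (0 : ℝ) 1, Filter.Tendsto (fun k => τ k t) Filter.atTop (nhds t) := by
    intro t ht
    by_cases hA' : t ∈ A
    · simp only [τ, SimpleFunc.piecewise_apply, if_pos hA']
      exact SimpleFunc.tendsto_approxOn measurable_id ha (subset_closure hA')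
    · simp only [τ, SimpleFunc.piecewise_apply, if_neg hA']
      exact SimpleFunc.tendsto_approxOn measurable_id (hA1 ha) (subset_closure ht)
  have hmeas : ∀ k, AEStronglyMeasurable (fun t => √(W2sq (μ t) (μ (τ k t))))
      (volume.restrict (Icc 0 1)) := fun k => by
    refine aestronglyMeasurable_comp_simpleFunc (τ k) (F := fun t s => √(W2sq (μ t) (μ s))) ?_
    intro s hs
    obtain ⟨t, rfl⟩ := SimpleFunc.mem_range.1 hs
    have := hp _ (hτ0 k t)
    exact (Real.continuous_sqrt.comp_continuousOn (hcont.continuousOn_W2sq hp hμ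
      (FinSecMom.of_compl_closedBall (hμ _ (hτ0 k t))))).aestronglyMeasurable measurableSet_Icc
  have hbound : ∀ k, ∀ t ∈ Icc (0 : ℝ) 1, ‖√(W2sq (μ t) (μ (τ k t)))‖ ≤ 2 * R := fun k t ht => by
    have := hp t ht
    have := hp _ (hτ0 k t)
    rw [Real.norm_of_nonneg (Real.sqrt_nonneg _)]
    exact (Real.sqrt_le_left (by positivity)).2
      (W2sq_le_of_compl_closedBall (hμ t ht) (hμ _ (hτ0 k t)))
  have hlim : Filter.Tendsto (fun k => ∫ t in Icc (0 : ℝ) 1, √(W2sq (μ t) (μ (τ k t))))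
      Filter.atTop (nhds (∫ t in Icc (0 : ℝ) 1, (0 : ℝ))) := by
    refine tendsto_integral_of_dominated_convergence (fun _ => 2 * R) hmeas (integrable_const _)
      (fun k => (ae_restrict_mem measurableSet_Icc).mono (hbound k)) ?_
    refine (ae_restrict_mem measurableSet_Icc).mono fun t ht => ?_
    have h1 : Filter.Tendsto (fun k => τ k t) Filter.atTop (nhdsWithin t (Icc 0 1)) :=
      tendsto_nhdsWithin_iff.2 ⟨hτl t ht, Filter.Eventually.of_forall fun k => hτ0 k t⟩
    simpa using ((hcont.tendsto_W2sq hp hμ ht).comp h1).sqrt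
  rw [integral_zero] at hlim
  obtain ⟨k, hk⟩ := (hlim.eventually (gt_mem_nhds he)).exists
  exact ⟨τ k, hτ0 k, hτ1 k, Integrable.of_bound (hmeas k) (2 * R)
    ((ae_restrict_mem measurableSet_Icc).mono (hbound k)), hk⟩

/-- If the members of a curve have density at most `K` on a set of times of measure at least `m`,
then arbitrarily close to the barycenter there are measures with an almost optimal density bound. -/
theorem IsBarycenter.exists_near {n : ℕ} (hn : n ≠ 0) {R : ℝ} (hR : 0 < R)
    {μ : ℝ → Measure (En n)} (hcont : WeakContOn μ (Icc 0 1))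
    (hp : ∀ t ∈ Icc (0 : ℝ) 1, IsProbabilityMeasure (μ t))
    (hμ : ∀ t ∈ Icc (0 : ℝ) 1, μ t (Metric.closedBall 0 R)ᶜ = 0) {A : Set ℝ}
    (hA : MeasurableSet A) (hA1 : A ⊆ Icc 0 1) {K m : ℝ} (hK : 0 ≤ K) (hm : 0 < m)
    (hmA : m ≤ volume.real A) (hAK : ∀ t ∈ A, μ t ≤ ENNReal.ofReal K • volume)
    {μb : Measure (En n)} (hb : IsBarycenter μ μb) {ε e : ℝ} (hε : 0 < ε) (he : 0 < e) :
    ∃ ν : Measure (En n), IsProbabilityMeasure ν ∧ FinSecMom ν ∧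
      ν ≤ ENNReal.ofReal (K * ((1 + ε) / m) ^ n) • volume ∧ W2sq μb ν < e := by
  classical
  have hbB := hb.compl_closedBall hR hcont hp hμ
  have hb0 := hb.1
  have hA0 : A.Nonempty := by
    by_contra! h
    rw [h, measureReal_empty] at hmA
    exact absurd hmA (not_le.2 hm)
  obtain ⟨τ, hτ0, hτ1, hτi, hτ⟩ := hcont.exists_simpleFunc hR hp hμ hA hA0 hA1
    (show 0 < ε * e / (8 * R) by positivity)
  set vol : Measure ℝ := volume.restrict (Icc 0 1) with hvol
  let J := τ.range.filter fun s => vol.real (τ ⁻¹' {s}) ≠ 0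
  let lam : J → ℝ := fun s => vol.real (τ ⁻¹' {s.1})
  have hJ : ∀ s ∈ J, s ∈ Icc (0 : ℝ) 1 := fun s hs => by
    obtain ⟨t, rfl⟩ := SimpleFunc.mem_range.1 (Finset.mem_filter.1 hs).1
    exact hτ0 t
  have hlam : ∀ s, 0 < lam s := fun s =>
    measureReal_nonneg.lt_of_ne (Finset.mem_filter.1 s.2).2.symm
  have hsum : ∀ ψ : ℝ → ℝ, ∑ s, lam s * ψ s = ∫ t in Icc (0 : ℝ) 1, ψ (τ t) := fun ψ => by
    rw [integral_comp_simpleFunc, Finset.sum_coe_sort J fun s => vol.real (τ ⁻¹' {s}) * ψ s]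
    refine Finset.sum_filter_of_ne fun s _ hs => left_ne_zero_of_mul hs
  have hτint : ∀ ψ : ℝ → ℝ, IntegrableOn (fun t => ψ (τ t)) (Icc 0 1) := fun ψ =>
    SimpleFunc.integrable_of_isFiniteMeasure (τ.map ψ)
  have hlam1 : ∑ s, lam s = 1 := by
    have := hsum fun _ => 1
    simpa using this
  let I : Finset J := Finset.univ.filter fun s => s.1 ∈ A
  have hmI : m ≤ ∑ s ∈ I, lam s := by
    have h1 : ∑ s ∈ I, lam s = ∫ t in Icc (0 : ℝ) 1, A.indicator 1 (τ t) := by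
      rw [← hsum, Finset.sum_filter]
      refine Finset.sum_congr rfl fun s _ => ?_
      simp [indicator_apply]
    have h2 : volume.real A = ∫ t in Icc (0 : ℝ) 1, A.indicator (1 : ℝ → ℝ) t := by
      rw [integral_indicator_one hA, measureReal_restrict_apply hA, inter_eq_left.2 hA1]
    rw [h1]
    refine hmA.trans (h2.trans_le ?_)
    refine integral_mono ((integrable_const (1 : ℝ)).indicator hA) (hτint _) fun t => ?_
    by_cases ht : t ∈ A
    · rw [indicator_of_mem ht, indicator_of_mem (hτ1 t ht)]
      exact le_rfl
    · rw [indicator_of_notMem ht]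
      exact indicator_nonneg (fun _ _ => zero_le_one) _
  have hpJ : ∀ s : J, IsProbabilityMeasure (μ s) := fun s => hp _ (hJ _ s.2)
  obtain ⟨ν, hν, hνB, hνK, hνle⟩ := exists_penalized_measure hn hR hlam (fun s : J => μ s)
    (fun s => hμ _ (hJ _ s.2)) μb hbB I hK hm hε hmI fun s hs => hAK _ (Finset.mem_filter.1 hs).2
  rw [hlam1] at hνK
  refine ⟨ν, hν, FinSecMom.of_compl_closedBall hνB, hνK, ?_⟩
  rw [hsum fun s => W2sq (μ s) ν, hsum fun s => W2sq (μ s) μb] at hνle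
  have hint : ∀ ρ : Measure (En n), IsProbabilityMeasure ρ → ρ (Metric.closedBall 0 R)ᶜ = 0 →
      IntegrableOn (fun t => W2sq (μ t) ρ) (Icc 0 1) := fun ρ _ hρ =>
    (hcont.continuousOn_W2sq hp hμ (FinSecMom.of_compl_closedBall hρ)).integrableOn_compact
      isCompact_Icc
  have hclose : ∀ ρ : Measure (En n), IsProbabilityMeasure ρ → ρ (Metric.closedBall 0 R)ᶜ = 0 →
      |(∫ t in Icc (0 : ℝ) 1, W2sq (μ t) ρ) - ∫ t in Icc (0 : ℝ) 1, W2sq (μ (τ t)) ρ| ≤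
        4 * R * ∫ t in Icc (0 : ℝ) 1, √(W2sq (μ t) (μ (τ t))) := fun ρ hρ hρB => by
    rw [← integral_sub (hint ρ hρ hρB) (hτint fun s => W2sq (μ s) ρ), ← integral_const_mul]
    refine (abs_integral_le_integral_abs).trans ?_
    refine setIntegral_mono_on ((hint ρ hρ hρB).sub (hτint fun s => W2sq (μ s) ρ)).abs
      (hτi.const_mul _) measurableSet_Icc fun t ht => ?_
    have := hp t ht
    have := hp _ (hτ0 t)
    exact abs_W2sq_sub_le hR (hμ t ht) (hμ _ (hτ0 t)) hρB
  have h1 := abs_le.1 (hclose ν hν hνB)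
  have h2 := abs_le.1 (hclose μb hb0 hbB)
  have h3 := hb.2.2 ν hν (FinSecMom.of_compl_closedBall hνB)
  rw [lt_div_iff₀ (by positivity)] at hτ
  have h4 : ε * W2sq μb ν < ε * e := by linarith [h1.1, h1.2, h2.1, h2.2]
  exact lt_of_mul_lt_mul_left h4 hε.le

/-- Upper density bounds on the members of a curve are inherited by the barycenter. -/
theorem IsBarycenter.le_smul_volume {n : ℕ} (hn : n ≠ 0) {R : ℝ} (hR : 0 < R)
    {μ : ℝ → Measure (En n)} (hcont : WeakContOn μ (Icc 0 1))
    (hp : ∀ t ∈ Icc (0 : ℝ) 1, IsProbabilityMeasure (μ t))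
    (hμ : ∀ t ∈ Icc (0 : ℝ) 1, μ t (Metric.closedBall 0 R)ᶜ = 0) {A : Set ℝ}
    (hA : MeasurableSet A) (hA1 : A ⊆ Icc 0 1) {K m : ℝ} (hK : 0 ≤ K) (hm : 0 < m)
    (hmA : m ≤ volume.real A) (hAK : ∀ t ∈ A, μ t ≤ ENNReal.ofReal K • volume)
    {μb : Measure (En n)} (hb : IsBarycenter μ μb) :
    μb ≤ ENNReal.ofReal (K / m ^ n) • volume := by
  have hb0 := hb.1
  refine le_smul_volume_of_W2sq_lt hb.2.1 fun e he => ?_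
  have h1 : Filter.Tendsto (fun ε : ℝ => K * ((1 + ε) / m) ^ n) (nhdsWithin 0 (Ioi 0))
      (nhds (K / m ^ n)) := by
    have h2 : Continuous fun ε : ℝ => K * ((1 + ε) / m) ^ n := by fun_prop
    have h3 := (h2.tendsto 0).mono_left (nhdsWithin_le_nhds (s := Ioi 0))
    simpa [div_eq_mul_inv] using h3
  obtain ⟨ε, h2, hε⟩ := ((h1.eventually (gt_mem_nhds (lt_add_of_pos_right _ he))).and
    self_mem_nhdsWithin).exists
  obtain ⟨ν, hν, hνs, hνK, hνe⟩ := hb.exists_near hn hR hcont hp hμ hA hA1 hK hm hmA hAK hε he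
  refine ⟨ν, hν, hνs, hνK.trans ?_, hνe⟩
  refine Measure.le_iff.2 fun s _ => ?_
  exact mul_le_mul_left (ENNReal.ofReal_le_ofReal h2.le) _

theorem WeakContOn.isClosed_le_smul_volume {n : ℕ} {R : ℝ} {μ : ℝ → Measure (En n)} {S : Set ℝ}
    (hS : IsClosed S) (hcont : WeakContOn μ S) (hp : ∀ t ∈ S, IsProbabilityMeasure (μ t))
    (hμ : ∀ t ∈ S, μ t (Metric.closedBall 0 R)ᶜ = 0) (K : ℝ) :
    IsClosed {t | t ∈ S ∧ μ t ≤ ENNReal.ofReal K • volume} := by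
  refine isClosed_of_closure_subset fun t ht => ?_
  set A := {t | t ∈ S ∧ μ t ≤ ENNReal.ofReal K • volume}
  have hAS : A ⊆ S := fun s hs => hs.1
  have htS : t ∈ S := hS.closure_subset_iff.2 hAS ht
  have := hp t htS
  refine ⟨htS, le_smul_volume_of_W2sq_lt (FinSecMom.of_compl_closedBall (hμ t htS))
    fun e he => ?_⟩
  have := mem_closure_iff_nhdsWithin_neBot.1 ht
  have h1 := (hcont.tendsto_W2sq hp hμ htS).mono_left (nhdsWithin_mono t hAS)
  obtain ⟨s, h2, hs⟩ := ((h1.eventually (gt_mem_nhds he)).and self_mem_nhdsWithin).exists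
  have := hp s hs.1
  refine ⟨μ s, this, FinSecMom.of_compl_closedBall (hμ s hs.1), hs.2.trans ?_, h2⟩
  refine Measure.le_iff.2 fun u _ => ?_
  exact mul_le_mul_left (ENNReal.ofReal_le_ofReal (by linarith)) _

/-- under Assumption B (with constant `K` on a time set of measure `m_K > 0`),
the barycenter is absolutely continuous with density bounded by `K / m_K^n`. -/
theorem stmt8 {n : ℕ} (M : Set (En n)) (hM : Bornology.IsBounded M)
    (μ : ℝ → Measure (En n)) (hprob : ∀ t ∈ Icc (0:ℝ) 1, IsProbabilityMeasure (μ t))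
    (hsupp : ∀ t ∈ Icc (0:ℝ) 1, μ t Mᶜ = 0)
    (hcont : WeakContOn μ (Icc 0 1))
    (K mK : ℝ) (hK : 0 < K) (g : ℝ → En n → ℝ) (AK : Set ℝ)
    (hAK : AK = {t | t ∈ Icc (0:ℝ) 1 ∧
      μ t = volume.withDensity (fun x => ENNReal.ofReal (g t x)) ∧
      eLpNorm (g t) ⊤ volume ≤ ENNReal.ofReal K})
    (hmK : volume AK = ENNReal.ofReal mK) (hmKpos : 0 < mK)
    (μb : Measure (En n)) (hbary : IsBarycenter μ μb) :
    ∃ gb : En n → ℝ, μb = volume.withDensity (fun x => ENNReal.ofReal (gb x)) ∧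
      eLpNorm gb ⊤ volume ≤ ENNReal.ofReal (K / mK ^ (n : ℝ)) := by
  have hb := hbary.1
  refine exists_density_of_le_smul_volume ?_
  rw [Real.rpow_natCast]
  have hle : ∀ t ∈ AK, t ∈ Icc (0 : ℝ) 1 ∧ μ t ≤ ENNReal.ofReal K • volume := by
    rw [hAK]
    rintro t ⟨ht, hgt, hgK⟩
    rw [hgt]
    exact ⟨ht, withDensity_le_smul_volume hgK⟩
  rcases eq_or_ne n 0 with rfl | hn
  · have hne : AK.Nonempty := by
      refine nonempty_of_measure_ne_zero (μ := volume) ?_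
      rw [hmK]
      exact (ENNReal.ofReal_pos.2 hmKpos).ne'
    obtain ⟨t, ht⟩ := hne
    have := hprob t (hle t ht).1
    have heq : μb = μ t := by
      ext s _
      rcases s.eq_empty_or_nonempty with rfl | hs
      · simp
      · rw [hs.eq_univ]
        simp
    rw [heq, pow_zero, div_one]
    exact (hle t ht).2
  · obtain ⟨R, hR, hMR⟩ := hM.subset_closedBall_lt 0 0
    have hμ : ∀ t ∈ Icc (0 : ℝ) 1, μ t (Metric.closedBall 0 R)ᶜ = 0 := fun t ht =>
      measure_mono_null (compl_subset_compl.2 hMR) (hsupp t ht)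
    have hcl := hcont.isClosed_le_smul_volume isClosed_Icc hprob hμ K
    refine hbary.le_smul_volume hn hR hcont hprob hμ hcl.measurableSet (fun t ht => ht.1) hK.le
      hmKpos ?_ fun t ht => ht.2
    have h1 : volume {t | t ∈ Icc (0 : ℝ) 1 ∧ μ t ≤ ENNReal.ofReal K • volume} ≠ ⊤ :=
      ((measure_mono fun t ht => ht.1).trans_lt (isCompact_Icc (a := (0 : ℝ)) (b := 1)
        |>.measure_lt_top)).ne
    rw [measureReal_def, ← ENNReal.ofReal_le_iff_le_toReal h1, ← hmK]
    exact measure_mono hle
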